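/- arXiv:0811.2935 — 2 statements merged into one kernel-verified Lean document; each statement's English description precedes it below -/
import Mathlib

section
/- Let s be an integer and let f = (f_R)_{R∈SO(3)} be a smooth spin-s function on S² (each f_R is C^∞ on U_R). Define A_{lm} = ∫₀^π ∫_{−π}^{π} f_I(θ,φ) conj(ₛY_{lm}(θ,φ)) dφ sin θ dθ, where f_I is expressed in spherical coordinates. Then: (i) the coefficients A_{lm} decay rapidly, i.e. for every N there exists C with |A_{lm}| ≤ C (l+1)^{−N} for all l ≥ |s|, −l ≤ m ≤ l; and (ii) the series Σ_{l ≥ |s|} Σ_{m=−l}^{l} A_{lm} ₛY_{lm} converges to f_I together with all partial derivatives in (θ,φ), uniformly on every compact subset of (0,π)×ℝ. -/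
noncomputable section

/-- Euclidean dot product on `ℝ³`. -/
def dot3 (v w : Fin 3 → ℝ) : ℝ := v 0 * w 0 + v 1 * w 1 + v 2 * w 2

/-- The set of special orthogonal `3×3` matrices (rotations). -/
def SO3set : Set (Matrix (Fin 3) (Fin 3) ℝ) := {R | R * R.transpose = 1 ∧ R.det = 1}

/-- The north pole. -/
def NP : Fin 3 → ℝ := ![0, 0, 1]

/-- The south pole. -/
def SP : Fin 3 → ℝ := ![0, 0, -1]

/-- `U_I = S² ∖ {N, S}`. -/
def UI : Set (Fin 3 → ℝ) := {p | dot3 p p = 1 ∧ p ≠ NP ∧ p ≠ SP}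

/-- The chart `U_R = R · U_I`; `p ∈ U_R ↔ R⁻¹ p ∈ U_I` (with `R⁻¹ = Rᵀ`). -/
def chartU (R : Matrix (Fin 3) (Fin 3) ℝ) : Set (Fin 3 → ℝ) :=
  {p | Matrix.mulVec R.transpose p ∈ UI}

/-- The reference direction `ρ_I(p) = (−y, x, 0)/√(x²+y²)`. -/
noncomputable def rhoI (p : Fin 3 → ℝ) : Fin 3 → ℝ :=
  (Real.sqrt (p 0 ^ 2 + p 1 ^ 2))⁻¹ • ![-(p 1), p 0, 0]

/-- The reference direction `ρ_R(p) = R · ρ_I(R⁻¹ p)` on the chart `U_R`. -/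
noncomputable def rhoR (R : Matrix (Fin 3) (Fin 3) ℝ) (p : Fin 3 → ℝ) : Fin 3 → ℝ :=
  Matrix.mulVec R (rhoI (Matrix.mulVec R.transpose p))

/-- The spin-`s` transformation law: whenever `ψ ∈ (−π, π]` satisfies
`ρ_{R₂}(p) = cos ψ · ρ_{R₁}(p) + sin ψ · (ρ_{R₁}(p) × p)` (i.e. `ψ` is the oriented angle from
`ρ_{R₁}(p)` to `ρ_{R₂}(p)`), one has `f_{R₂}(p) = e^{isψ} f_{R₁}(p)`. -/
def IsSpinFamily (s : ℤ) (f : Matrix (Fin 3) (Fin 3) ℝ → (Fin 3 → ℝ) → ℂ) : Prop :=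
  ∀ R₁ ∈ SO3set, ∀ R₂ ∈ SO3set, ∀ p ∈ chartU R₁ ∩ chartU R₂,
    ∀ ψ ∈ Set.Ioc (-Real.pi) Real.pi,
      rhoR R₂ p = Real.cos ψ • rhoR R₁ p + Real.sin ψ • (crossProduct (rhoR R₁ p) p) →
        f R₂ p = Complex.exp (Complex.I * (s : ℂ) * (ψ : ℂ)) * f R₁ p

/-- Standard spherical coordinates. -/
noncomputable def sphCoords (θ φ : ℝ) : Fin 3 → ℝ :=
  ![Real.sin θ * Real.cos φ, Real.sin θ * Real.sin φ, Real.cos θ]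
/-- Integer binomial coefficient, zero outside `0 ≤ j ≤ n`. -/
def izbinom (n j : ℤ) : ℕ := if 0 ≤ j ∧ j ≤ n then n.toNat.choose j.toNat else 0

/-- The normalization constant `a_{lm} = √((l+m)!(l−m)!(2l+1)/(4π))`. -/
noncomputable def alm (l m : ℤ) : ℝ :=
  Real.sqrt ((((l + m).toNat.factorial : ℝ) * ((l - m).toNat.factorial : ℝ) * (2 * (l : ℝ) + 1)) /
    (4 * Real.pi))

/-- The spin-`s` spherical harmonic `ₛY_{lm}` in the standard chart, as a function of `(θ, φ)`. -/
noncomputable def sY (s l m : ℤ) (x : ℝ × ℝ) : ℂ :=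
  Complex.exp (Complex.I * (m : ℂ) * (x.2 : ℂ)) * (-1 : ℂ) ^ (max (-m) 0) *
    ((alm l m / Real.sqrt (((l + s).toNat.factorial : ℝ) * ((l - s).toNat.factorial : ℝ)) : ℝ) : ℂ) *
    ((Real.sin (x.1 / 2) : ℂ)) ^ (2 * l) *
    ∑ r ∈ Finset.Icc (0 : ℤ) (l - s),
      (izbinom (l - s) r : ℂ) * (izbinom (l + s) (r + s - m) : ℂ) * (-1 : ℂ) ^ (l - r - s) *
        ((Real.cos (x.1 / 2) / Real.sin (x.1 / 2) : ℝ) : ℂ) ^ (2 * r + s - m)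
/-- Partial derivative in the first variable. -/
noncomputable def pdθ (h : ℝ × ℝ → ℂ) : ℝ × ℝ → ℂ := fun x => deriv (fun t => h (t, x.2)) x.1

/-- Partial derivative in the second variable. -/
noncomputable def pdφ (h : ℝ × ℝ → ℂ) : ℝ × ℝ → ℂ := fun x => deriv (fun t => h (x.1, t)) x.2

open Polynomial in
/-- The generating polynomial `(t cos(θ/2) - sin(θ/2))^p (cos(θ/2) + t sin(θ/2))^q` in `t`. -/
def genPoly (p q : ℕ) (θ : ℝ) : ℝ[X] :=
  (C (Real.cos (θ / 2)) * X - C (Real.sin (θ / 2))) ^ p *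
    (C (Real.cos (θ / 2)) + C (Real.sin (θ / 2)) * X) ^ q

open Polynomial in
/-- Coefficientwise differentiability of a polynomial-valued function. -/
def HasCoeffDerivAt (P : ℝ → ℝ[X]) (P' : ℝ[X]) (θ : ℝ) : Prop :=
  ∀ k, HasDerivAt (fun t => (P t).coeff k) (P'.coeff k) θ

namespace HasCoeffDerivAt
open Polynomial

theorem mul {P Q : ℝ → ℝ[X]} {P' Q' : ℝ[X]} {θ : ℝ} (hP : HasCoeffDerivAt P P' θ)
    (hQ : HasCoeffDerivAt Q Q' θ) :
    HasCoeffDerivAt (fun t => P t * Q t) (P' * Q θ + P θ * Q') θ := by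
  intro k
  simp only [coeff_mul, coeff_add]
  rw [← Finset.sum_add_distrib]
  exact HasDerivAt.fun_sum fun i _ => (hP i.1).mul (hQ i.2)

theorem pow {P : ℝ → ℝ[X]} {P' : ℝ[X]} {θ : ℝ} (hP : HasCoeffDerivAt P P' θ) (n : ℕ) :
    HasCoeffDerivAt (fun t => P t ^ n) (C (n : ℝ) * P θ ^ (n - 1) * P') θ := by
  induction n with
  | zero => intro k; simpa using hasDerivAt_const θ ((1 : ℝ[X]).coeff k)
  | succ n ih =>
    have h := ih.mul hP
    simp only [pow_succ]
    convert h using 1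
    rcases n with _ | n
    · simp
    · simp only [Nat.add_sub_cancel, Nat.cast_add, Nat.cast_one, C_add, C_1]
      ring

end HasCoeffDerivAt

section genPoly
open Polynomial

theorem hasCoeffDerivAt_genPoly (p q : ℕ) (θ : ℝ) :
    HasCoeffDerivAt (genPoly p q)
      (C (1 / 2) * (C (q : ℝ) * genPoly (p + 1) (q - 1) θ - C (p : ℝ) * genPoly (p - 1) (q + 1) θ))
      θ := by
  have hc : HasDerivAt (fun t : ℝ => Real.cos (t / 2)) (-(1 / 2 * Real.sin (θ / 2))) θ := by
    convert ((hasDerivAt_id' θ).div_const 2).cos using 1; ring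
  have hs : HasDerivAt (fun t : ℝ => Real.sin (t / 2)) (1 / 2 * Real.cos (θ / 2)) θ := by
    convert ((hasDerivAt_id' θ).div_const 2).sin using 1; ring
  have hA : HasCoeffDerivAt (fun t => C (Real.cos (t / 2)) * X - C (Real.sin (t / 2)))
      (-(C (1 / 2) * (C (Real.cos (θ / 2)) + C (Real.sin (θ / 2)) * X))) θ := by
    intro k
    rcases k with _ | _ | k
    · simpa using hs.fun_neg
    · simpa [coeff_C] using hc
    · simpa [coeff_C, coeff_X] using hasDerivAt_const θ (0 : ℝ)
  have hB : HasCoeffDerivAt (fun t => C (Real.cos (t / 2)) + C (Real.sin (t / 2)) * X)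
      (C (1 / 2) * (C (Real.cos (θ / 2)) * X - C (Real.sin (θ / 2)))) θ := by
    intro k
    rcases k with _ | _ | k
    · simpa using hc
    · simpa [coeff_C] using hs
    · simpa [coeff_C, coeff_X] using hasDerivAt_const θ (0 : ℝ)
  have h := (hA.pow p).mul (hB.pow q)
  change HasCoeffDerivAt (fun t => genPoly p q t) _ θ at h
  convert h using 1
  simp only [genPoly]
  rcases p with _ | p <;> rcases q with _ | q <;>
    simp only [Nat.add_sub_cancel, Nat.cast_zero, C_0] <;> ring

theorem X_mul_derivative_genPoly (p q : ℕ) (θ : ℝ) :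
    X * derivative (genPoly p q θ) =
      C ((p + q - (q - p) * Real.cos θ) / 2) * genPoly p q θ +
        C (Real.sin θ / 2) * (C (p : ℝ) * genPoly (p - 1) (q + 1) θ +
          C (q : ℝ) * genPoly (p + 1) (q - 1) θ) := by
  set c := Real.cos (θ / 2) with hc
  set σ := Real.sin (θ / 2) with hσ
  have h1 : c ^ 2 + σ ^ 2 = 1 := Real.cos_sq_add_sin_sq _
  have hcos : Real.cos θ = c ^ 2 - σ ^ 2 := by
    have := Real.cos_sq' (θ / 2)
    have h2 := Real.cos_two_mul (θ / 2)
    rw [show 2 * (θ / 2) = θ by ring] at h2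
    rw [h2]; linarith
  have hsin : Real.sin θ = 2 * σ * c := by
    have h2 := Real.sin_two_mul (θ / 2)
    rwa [show 2 * (θ / 2) = θ by ring] at h2
  have hX : (C c ^ 2 + C σ ^ 2 : ℝ[X]) = 1 := by
    rw [← C_pow, ← C_pow, ← C_add, h1, C_1]
  have e1 : (p + q - (q - p) * Real.cos θ) / 2 = p * c ^ 2 + q * σ ^ 2 := by
    rw [hcos]; linear_combination (-(p + q) / 2 : ℝ) * h1
  have e2 : Real.sin θ / 2 = σ * c := by rw [hsin]; ring
  rw [e1, e2]
  simp only [genPoly, ← hc, ← hσ]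
  have hA : (C c * X : ℝ[X]) = C c ^ 2 * (C c * X - C σ) + C c * C σ * (C c + C σ * X) := by
    linear_combination (-(C c * X)) * hX
  have hB : (C σ * X : ℝ[X]) = C c * C σ * (C c * X - C σ) + C σ ^ 2 * (C c + C σ * X) := by
    linear_combination (-(C σ * X)) * hX
  simp only [derivative_mul, derivative_pow, derivative_sub, derivative_add, derivative_C,
    derivative_X, C_add, C_mul, C_pow]
  set A := (C c * X - C σ : ℝ[X])
  set B := (C c + C σ * X : ℝ[X])
  rcases p with _ | p <;> rcases q with _ | q <;>
    simp only [Nat.add_sub_cancel, Nat.cast_zero, C_0]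
  · ring
  · linear_combination (C ((q + 1 : ℕ) : ℝ) * B ^ q) * hB
  · linear_combination (C ((p + 1 : ℕ) : ℝ) * A ^ p) * hA
  · linear_combination (C ((q + 1 : ℕ) : ℝ) * B ^ q * A ^ (p + 1)) * hB +
      (C ((p + 1 : ℕ) : ℝ) * A ^ p * B ^ (q + 1)) * hA

theorem coeff_X_mul_derivative (P : ℝ[X]) (k : ℕ) :
    (X * derivative P).coeff k = k * P.coeff k := by
  rcases k with _ | k
  · simp
  · rw [coeff_X_mul, coeff_derivative]; push_cast; ring

end genPoly

/-- The polar part of the spin-`s` harmonic, without the sign `(-1)^{max(-m,0)}`; it is zero unless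
`|s| ≤ l` and `|m| ≤ l`. -/
def polarY (l s m : ℤ) (θ : ℝ) : ℝ :=
  if |s| ≤ l ∧ |m| ≤ l then
    alm l m / Real.sqrt (((l + s).toNat.factorial : ℝ) * ((l - s).toNat.factorial : ℝ)) *
      (genPoly (l - s).toNat (l + s).toNat θ).coeff (l + m).toNat
  else 0

/-- The ladder coefficient `√((l+s)(l-s+1))`. -/
def ladder (l s : ℤ) : ℝ := Real.sqrt (((l : ℝ) + s) * ((l : ℝ) - s + 1))

theorem polarY_of_not {l s m : ℤ} (h : ¬(|s| ≤ l ∧ |m| ≤ l)) (θ : ℝ) : polarY l s m θ = 0 :=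
  if_neg h

theorem polarY_of_nat {l s m : ℤ} {p q : ℕ} (hp : l - s = p) (hq : l + s = q) (hm : |m| ≤ l)
    (θ : ℝ) : polarY l s m θ =
      alm l m / Real.sqrt ((q.factorial : ℝ) * (p.factorial : ℝ)) *
        (genPoly p q θ).coeff (l + m).toNat := by
  have hs : |s| ≤ l := by rw [abs_le]; omega
  rw [polarY, if_pos ⟨hs, hm⟩, hp, hq, Int.toNat_natCast, Int.toNat_natCast]

theorem sqrt_factorial_ladder (p q : ℕ) :
    Real.sqrt (((q : ℝ) + 1) * ((p : ℝ) + 1)) /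
      Real.sqrt ((q.factorial : ℝ) * ((p + 1).factorial : ℝ)) =
    ((q : ℝ) + 1) / Real.sqrt (((q + 1).factorial : ℝ) * (p.factorial : ℝ)) := by
  have hq : (0 : ℝ) < q + 1 := by positivity
  have hp : (0 : ℝ) < p + 1 := by positivity
  have hqf : (0 : ℝ) < q.factorial := by positivity
  have hpf : (0 : ℝ) < p.factorial := by positivity
  rw [Nat.factorial_succ, Nat.factorial_succ]
  push_cast
  rw [Real.sqrt_mul hq.le, Real.sqrt_mul hqf.le, Real.sqrt_mul hp.le,
    Real.sqrt_mul (by positivity), Real.sqrt_mul hq.le]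
  have h1 := Real.sqrt_pos.2 hq
  have h2 := Real.sqrt_pos.2 hp
  have h3 := Real.sqrt_pos.2 hqf
  have h4 := Real.sqrt_pos.2 hpf
  field_simp
  exact Real.sq_sqrt hq.le

theorem ladder_mul_polarY_sub_one {l s m : ℤ} {p q : ℕ} (hp : l - s = p) (hq : l + s = q)
    (hm : |m| ≤ l) (θ : ℝ) : ladder l s * polarY l (s - 1) m θ =
      alm l m / Real.sqrt ((q.factorial : ℝ) * (p.factorial : ℝ)) *
        (q * (genPoly (p + 1) (q - 1) θ).coeff (l + m).toNat) := by
  have hpR : (l : ℝ) - s = p := by exact_mod_cast hp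
  have hqR : (l : ℝ) + s = q := by exact_mod_cast hq
  rcases q with _ | q
  · rw [ladder, hqR]; simp
  · rw [polarY_of_nat (p := p + 1) (q := q) (by push_cast; omega) (by push_cast at hq; omega) hm,
      ladder, hqR, hpR]
    have h := sqrt_factorial_ladder p q
    simp only [Nat.add_sub_cancel]
    push_cast
    rw [div_mul_eq_mul_div, div_mul_eq_mul_div, mul_div_assoc', mul_left_comm, mul_div_right_comm,
      mul_div_right_comm]
    linear_combination (alm l m * (genPoly (p + 1) q θ).coeff (l + m).toNat) * h

theorem ladder_mul_polarY_add_one {l s m : ℤ} {p q : ℕ} (hp : l - s = p) (hq : l + s = q)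
    (hm : |m| ≤ l) (θ : ℝ) : ladder l (s + 1) * polarY l (s + 1) m θ =
      alm l m / Real.sqrt ((q.factorial : ℝ) * (p.factorial : ℝ)) *
        (p * (genPoly (p - 1) (q + 1) θ).coeff (l + m).toNat) := by
  have hpR : (l : ℝ) - s = p := by exact_mod_cast hp
  have hqR : (l : ℝ) + s = q := by exact_mod_cast hq
  have e : ladder l (s + 1) = Real.sqrt ((p : ℝ) * (q + 1)) := by
    rw [ladder, ← hpR, ← hqR]; push_cast; ring_nf
  rcases p with _ | p
  · rw [e]; simp
  · rw [polarY_of_nat (p := p) (q := q + 1) (by push_cast at hp; omega) (by push_cast; omega) hm, e]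
    have h := sqrt_factorial_ladder q p
    rw [mul_comm (p.factorial : ℝ), mul_comm ((p + 1).factorial : ℝ)] at h
    simp only [Nat.add_sub_cancel]
    push_cast
    rw [div_mul_eq_mul_div, div_mul_eq_mul_div, mul_div_assoc', mul_left_comm, mul_div_right_comm,
      mul_div_right_comm]
    linear_combination (alm l m * (genPoly p (q + 1) θ).coeff (l + m).toNat) * h

theorem ladder_mul_eq_zero {l s m : ℤ} (h : ¬(|s| ≤ l ∧ |m| ≤ l)) (θ : ℝ) :
    ladder l s * polarY l (s - 1) m θ = 0 ∧ ladder l (s + 1) * polarY l (s + 1) m θ = 0 := by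
  by_cases hm : |m| ≤ l
  · have hs : ¬ |s| ≤ l := fun hs => h ⟨hs, hm⟩
    constructor
    · by_cases hs1 : |s - 1| ≤ l
      · have : s = l + 1 := by rw [abs_le] at hs hs1; omega
        simp [ladder, this]
      · rw [polarY_of_not (fun h => hs1 h.1), mul_zero]
    · by_cases hs1 : |s + 1| ≤ l
      · have : s = -l - 1 := by rw [abs_le] at hs hs1; omega
        simp [ladder, this]
      · rw [polarY_of_not (fun h => hs1 h.1), mul_zero]
  · rw [polarY_of_not (fun h => hm h.2), polarY_of_not (fun h => hm h.2)]; simp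

theorem hasDerivAt_polarY (l s m : ℤ) (θ : ℝ) :
    HasDerivAt (polarY l s m)
      ((ladder l s * polarY l (s - 1) m θ - ladder l (s + 1) * polarY l (s + 1) m θ) / 2) θ := by
  by_cases h : |s| ≤ l ∧ |m| ≤ l
  · obtain ⟨p, hp⟩ := Int.eq_ofNat_of_zero_le (a := l - s) (by have := h.1; rw [abs_le] at this; omega)
    obtain ⟨q, hq⟩ := Int.eq_ofNat_of_zero_le (a := l + s) (by have := h.1; rw [abs_le] at this; omega)
    rw [ladder_mul_polarY_sub_one hp hq h.2, ladder_mul_polarY_add_one hp hq h.2]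
    have h1 := (hasCoeffDerivAt_genPoly p q θ (l + m).toNat).const_mul
      (alm l m / Real.sqrt ((q.factorial : ℝ) * (p.factorial : ℝ)))
    rw [show polarY l s m = _ from funext (polarY_of_nat hp hq h.2)]
    refine h1.congr_deriv ?_
    simp only [Polynomial.coeff_C_mul, Polynomial.coeff_sub]
    ring
  · rw [(ladder_mul_eq_zero h θ).1, (ladder_mul_eq_zero h θ).2,
      show polarY l s m = fun _ => 0 from funext (polarY_of_not h)]
    simpa using hasDerivAt_const θ (0 : ℝ)

theorem polarY_recurrence (l s m : ℤ) (θ : ℝ) :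
    (m + s * Real.cos θ) * polarY l s m θ = Real.sin θ *
      ((ladder l (s + 1) * polarY l (s + 1) m θ + ladder l s * polarY l (s - 1) m θ) / 2) := by
  by_cases h : |s| ≤ l ∧ |m| ≤ l
  · obtain ⟨p, hp⟩ := Int.eq_ofNat_of_zero_le (a := l - s) (by have := h.1; rw [abs_le] at this; omega)
    obtain ⟨q, hq⟩ := Int.eq_ofNat_of_zero_le (a := l + s) (by have := h.1; rw [abs_le] at this; omega)
    rw [ladder_mul_polarY_sub_one hp hq h.2, ladder_mul_polarY_add_one hp hq h.2,
      polarY_of_nat hp hq h.2]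
    have h1 := congrArg (fun P => P.coeff (l + m).toNat) (X_mul_derivative_genPoly p q θ)
    simp only [coeff_X_mul_derivative, Polynomial.coeff_C_mul, Polynomial.coeff_add] at h1
    have hpR : (l : ℝ) - s = p := by exact_mod_cast hp
    have hqR : (l : ℝ) + s = q := by exact_mod_cast hq
    have hk : (((l + m).toNat : ℕ) : ℝ) = l + m := by
      have : (((l + m).toNat : ℕ) : ℤ) = l + m := Int.toNat_of_nonneg (by
        have := h.2; rw [abs_le] at this; omega)
      exact_mod_cast this
    rw [hk] at h1
    have e : (l + m : ℝ) - (p + q - (q - p) * Real.cos θ) / 2 = m + s * Real.cos θ := by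
      rw [← hpR, ← hqR]; ring
    rw [← e]
    linear_combination (alm l m / Real.sqrt ((q.factorial : ℝ) * (p.factorial : ℝ))) * h1
  · rw [(ladder_mul_eq_zero h θ).1, (ladder_mul_eq_zero h θ).2, polarY_of_not h]; simp

theorem continuous_polarY (l s m : ℤ) : Continuous (polarY l s m) :=
  continuous_iff_continuousAt.2 fun θ => (hasDerivAt_polarY l s m θ).continuousAt

theorem ladder_self_neg (l : ℤ) : ladder l (-l) = 0 := by simp [ladder]

theorem ladder_add_one_self (l : ℤ) : ladder l (l + 1) = 0 := by simp [ladder]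

theorem ladder_le {l : ℤ} (hl : 0 ≤ l) (s : ℤ) : ladder l s ≤ l + 1 := by
  have hl' : (0 : ℝ) ≤ l := by exact_mod_cast hl
  rw [ladder]
  refine Real.sqrt_le_iff.2 ⟨by positivity, ?_⟩
  nlinarith [sq_nonneg ((2 : ℝ) * s - 1)]

theorem ladder_nonneg (l s : ℤ) : 0 ≤ ladder l s := Real.sqrt_nonneg _

theorem ladder_sq {l s : ℤ} (h1 : -l ≤ s) (h2 : s ≤ l + 1) :
    ladder l s ^ 2 = ((l : ℝ) + s) * ((l : ℝ) - s + 1) := by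
  rw [ladder, Real.sq_sqrt]
  have h1' : (-l : ℝ) ≤ s := by exact_mod_cast h1
  have h2' : (s : ℝ) ≤ l + 1 := by exact_mod_cast h2
  exact mul_nonneg (by linarith) (by linarith)

theorem alm_sq {l m : ℤ} (hl : 0 ≤ l) : alm l m ^ 2 =
    (((l + m).toNat.factorial : ℝ) * ((l - m).toNat.factorial : ℝ) * (2 * (l : ℝ) + 1)) /
      (4 * Real.pi) := by
  have hl' : (0 : ℝ) ≤ l := by exact_mod_cast hl
  rw [alm, Real.sq_sqrt (by positivity)]

theorem alm_pos {l m : ℤ} (hl : 0 ≤ l) : 0 < alm l m := by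
  have hl' : (0 : ℝ) ≤ l := by exact_mod_cast hl
  exact Real.sqrt_pos.2 (by positivity)

theorem polarY_zero (l s m : ℤ) (hl : |s| ≤ l) (hm : |m| ≤ l) :
    polarY l s m 0 ^ 2 = if s = -m then (2 * (l : ℝ) + 1) / (4 * Real.pi) else 0 := by
  have hl0 : 0 ≤ l := (abs_nonneg s).trans hl
  have hg : genPoly (l - s).toNat (l + s).toNat 0 = Polynomial.X ^ (l - s).toNat := by
    simp [genPoly]
  rw [polarY, if_pos ⟨hl, hm⟩, hg, Polynomial.coeff_X_pow]
  rw [abs_le] at hl hm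
  split_ifs with h1 h2 h2
  · subst h2
    have e : l - -m = l + m := by ring
    have e' : l + -m = l - m := by ring
    rw [mul_one, div_pow, alm_sq hl0, e, e', Real.sq_sqrt (by positivity)]
    field_simp
  · omega
  · omega
  · simp

theorem sum_sq_polarY (l m : ℤ) (hm : |m| ≤ l) (θ : ℝ) :
    ∑ j ∈ Finset.range (2 * l + 1).toNat, polarY l (-l + j) m θ ^ 2 =
      (2 * (l : ℝ) + 1) / (4 * Real.pi) := by
  have hl0 : 0 ≤ l := (abs_nonneg m).trans hm
  have hd : ∀ t, HasDerivAt
      (fun t => ∑ j ∈ Finset.range (2 * l + 1).toNat, polarY l (-l + j) m t ^ 2) 0 t := by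
    intro t
    have h1 := HasDerivAt.fun_sum (u := Finset.range (2 * l + 1).toNat)
      fun (j : ℕ) _ => (hasDerivAt_polarY l (-l + j) m t).fun_pow 2
    refine h1.congr_deriv ?_
    set T : ℕ → ℝ := fun j =>
      ladder l (-l + j) * polarY l (-l + j) m t * polarY l (-l + j - 1) m t with hT
    have h2 : ∀ j : ℕ, T j - T (j + 1) = ((2 : ℕ) : ℝ) * polarY l (-l + ↑j) m t ^ (2 - 1) *
        ((ladder l (-l + ↑j) * polarY l (-l + ↑j - 1) m t -
          ladder l (-l + ↑j + 1) * polarY l (-l + ↑j + 1) m t) / 2) := by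
      intro j
      have e1 : -l + ((j + 1 : ℕ) : ℤ) = -l + j + 1 := by push_cast; ring
      have e2 : -l + (j : ℤ) + 1 - 1 = -l + j := by ring
      simp only [hT, e1, e2]
      norm_num
      ring
    rw [Finset.sum_congr rfl fun j _ => (h2 j).symm, Finset.sum_range_sub']
    have e3 : -l + ((2 * l + 1).toNat : ℤ) = l + 1 := by omega
    simp only [hT, e3, ladder_add_one_self]
    simp [ladder_self_neg]
  have hconst := is_const_of_deriv_eq_zero (fun t => (hd t).differentiableAt)
    (fun t => (hd t).deriv) θ 0
  rw [hconst]
  rw [abs_le] at hm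
  rw [Finset.sum_eq_single (l - m).toNat]
  · rw [polarY_zero _ _ _ (by rw [abs_le]; omega) (by rw [abs_le]; omega), if_pos (by omega)]
  · intro j hj hj'
    rw [Finset.mem_range] at hj
    rw [polarY_zero _ _ _ (by rw [abs_le]; omega) (by rw [abs_le]; omega), if_neg (by omega)]
  · intro h
    rw [Finset.mem_range] at h
    omega

theorem abs_polarY_le {l : ℤ} (hl : 0 ≤ l) (s m : ℤ) (θ : ℝ) : |polarY l s m θ| ≤ l + 1 := by
  have hl' : (0 : ℝ) ≤ l := by exact_mod_cast hl
  by_cases h : |s| ≤ l ∧ |m| ≤ l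
  · have h1 := sum_sq_polarY l m h.2 θ
    have hs := abs_le.1 h.1
    have h2 := Finset.single_le_sum (s := Finset.range (2 * l + 1).toNat)
      (f := fun j : ℕ => polarY l (-l + j) m θ ^ 2) (fun _ _ => sq_nonneg _)
      (a := (l + s).toNat) (by rw [Finset.mem_range]; omega)
    have e : -l + ((l + s).toNat : ℤ) = s := by omega
    simp only [e, h1] at h2
    refine abs_le_of_sq_le_sq (h2.trans ?_) (by positivity)
    rw [div_le_iff₀ (by positivity)]
    nlinarith [Real.pi_gt_three]
  · rw [polarY_of_not h, abs_zero]; positivity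

theorem deriv_polarY (l s m : ℤ) : deriv (polarY l s m) = fun θ =>
    ladder l s / 2 * polarY l (s - 1) m θ - ladder l (s + 1) / 2 * polarY l (s + 1) m θ := by
  funext θ
  rw [(hasDerivAt_polarY l s m θ).deriv]
  ring

theorem contDiff_polarY (l s m : ℤ) : ContDiff ℝ (⊤ : ℕ∞) (polarY l s m) := by
  rw [contDiff_infty]
  intro n
  induction n generalizing s with
  | zero => exact contDiff_zero.2 (continuous_polarY l s m)
  | succ n ih =>
    push_cast
    rw [contDiff_succ_iff_deriv]
    refine ⟨fun θ => (hasDerivAt_polarY l s m θ).differentiableAt, by simp, ?_⟩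
    rw [deriv_polarY]
    exact (contDiff_const.mul (ih _)).sub (contDiff_const.mul (ih _))

theorem abs_iteratedDeriv_polarY_le {l : ℤ} (hl : 0 ≤ l) (s m : ℤ) (i : ℕ) (θ : ℝ) :
    |iteratedDeriv i (polarY l s m) θ| ≤ ((l : ℝ) + 1) ^ (i + 1) := by
  have hl' : (0 : ℝ) ≤ l := by exact_mod_cast hl
  induction i generalizing s with
  | zero => simpa using abs_polarY_le hl s m θ
  | succ i ih =>
    have hc : ∀ s', ContDiffAt ℝ i (polarY l s' m) θ := fun s' =>
      ((contDiff_polarY l s' m).of_le (by exact_mod_cast le_top)).contDiffAt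
    rw [iteratedDeriv_succ', deriv_polarY, iteratedDeriv_fun_sub (contDiffAt_const.mul (hc _))
      (contDiffAt_const.mul (hc _)), iteratedDeriv_const_mul_field, iteratedDeriv_const_mul_field]
    refine (abs_sub _ _).trans ?_
    rw [abs_mul, abs_mul, abs_of_nonneg (a := ladder l s / 2) (by have := ladder_nonneg l s; positivity),
      abs_of_nonneg (a := ladder l (s + 1) / 2)
        (by have := ladder_nonneg l (s + 1); positivity)]
    have h1 := mul_le_mul (ladder_le hl s) (ih (s - 1)) (abs_nonneg _) (by positivity)
    have h2 := mul_le_mul (ladder_le hl (s + 1)) (ih (s + 1)) (abs_nonneg _) (by positivity)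
    rw [pow_succ _ (i + 1)]
    linarith

section coeff
open Polynomial

theorem coeff_C_mul_X_add_C_pow (a b : ℝ) (n r : ℕ) :
    ((C a * X + C b) ^ n).coeff r = a ^ r * b ^ (n - r) * (n.choose r) := by
  have h : ((C a * X + C b) ^ n : ℝ[X]) = ((X + C b) ^ n).comp (C a * X) := by
    simp [pow_comp]
  rw [h, comp_C_mul_X_coeff, coeff_X_add_C_pow]
  ring

theorem coeff_genPoly (p q k : ℕ) (θ : ℝ) : (genPoly p q θ).coeff k =
    ∑ r ∈ Finset.range (k + 1), Real.cos (θ / 2) ^ r * (-Real.sin (θ / 2)) ^ (p - r) *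
      (p.choose r) * (Real.sin (θ / 2) ^ (k - r) * Real.cos (θ / 2) ^ (q - (k - r)) *
        (q.choose (k - r))) := by
  have h : genPoly p q θ = (C (Real.cos (θ / 2)) * X + C (-Real.sin (θ / 2))) ^ p *
      (C (Real.sin (θ / 2)) * X + C (Real.cos (θ / 2))) ^ q := by
    rw [genPoly, C_neg, sub_eq_add_neg, add_comm (C (Real.cos (θ / 2)))]
  rw [h, coeff_mul, Finset.Nat.sum_antidiagonal_eq_sum_range_succ_mk]
  simp only [coeff_C_mul_X_add_C_pow]

/-- The polynomial factor, in `cos²(θ/2)`, of a coefficient of `genPoly`. -/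
def polarPoly (p q k r₀ j : ℕ) : ℝ[X] :=
  ∑ i ∈ Finset.range (j + 1), C ((-1 : ℝ) ^ (p - (r₀ + i)) * (p.choose (r₀ + i)) *
    (q.choose (k - (r₀ + i)))) * (X ^ i * (1 - X) ^ (j - i))

theorem degree_polarPoly {p q k r₀ j : ℕ} (h1 : r₀ + j ≤ p) (h2 : r₀ + j ≤ k) (h3 : k ≤ q + r₀) :
    (polarPoly p q k r₀ j).degree = j := by
  have hdeg : ∀ i ∈ Finset.range (j + 1), (X ^ i * (1 - X) ^ (j - i) : ℝ[X]).natDegree ≤ j := by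
    intro i hi
    rw [Finset.mem_range] at hi
    have : (1 - X : ℝ[X]).natDegree ≤ 1 := by compute_degree
    refine (natDegree_mul_le_of_le (natDegree_X_pow_le i) (natDegree_pow_le_of_le (j - i) this)).trans ?_
    omega
  have hcoeff : ∀ i ∈ Finset.range (j + 1),
      (X ^ i * (1 - X) ^ (j - i) : ℝ[X]).coeff j = (-1) ^ (j - i) := by
    intro i hi
    rw [Finset.mem_range] at hi
    have e : (1 - X : ℝ[X]) = C (-1) * X + C 1 := by simp; ring
    conv_lhs => rw [show j = (j - i) + i by omega]
    rw [coeff_X_pow_mul, show j - i + i - i = j - i by omega, e, coeff_C_mul_X_add_C_pow]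
    simp
  refine degree_eq_of_le_of_coeff_ne_zero ?_ ?_
  · refine natDegree_le_iff_degree_le.1 (natDegree_sum_le_of_forall_le _ _ fun i hi => ?_)
    exact (natDegree_C_mul_le _ _).trans (hdeg i hi)
  · rw [polarPoly, finsetSum_coeff]
    have : ∀ i ∈ Finset.range (j + 1), (C ((-1 : ℝ) ^ (p - (r₀ + i)) * (p.choose (r₀ + i)) *
        (q.choose (k - (r₀ + i)))) * (X ^ i * (1 - X) ^ (j - i))).coeff j =
        (-1) ^ (p + r₀ + j) * ((p.choose (r₀ + i)) * (q.choose (k - (r₀ + i))) : ℝ) := by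
      intro i hi
      rw [coeff_C_mul, hcoeff i hi]
      rw [Finset.mem_range] at hi
      have e : p + r₀ + j = (p - (r₀ + i)) + (j - i) + 2 * (r₀ + i) := by omega
      rw [e, pow_add, pow_mul, pow_add]
      norm_num
      ring
    rw [Finset.sum_congr rfl this, ← Finset.mul_sum]
    refine mul_ne_zero (pow_ne_zero _ (by norm_num)) (ne_of_gt ?_)
    refine Finset.sum_pos (fun i hi => ?_) ⟨0, by simp⟩
    rw [Finset.mem_range] at hi
    have := Nat.choose_pos (n := p) (k := r₀ + i) (by omega)
    have := Nat.choose_pos (n := q) (k := k - (r₀ + i)) (by omega)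
    positivity

theorem coeff_genPoly_eq_polarPoly {p q k r₀ j a b : ℕ} (h1 : r₀ + j ≤ p) (h2 : r₀ + j ≤ k)
    (h3 : k ≤ q + r₀) (h4 : p = r₀ + j ∨ k = r₀ + j) (h5 : r₀ = 0 ∨ k = q + r₀)
    (ha : a + k = q + 2 * r₀) (hb : b + 2 * (r₀ + j) = p + k) (θ : ℝ) :
    (genPoly p q θ).coeff k = Real.cos (θ / 2) ^ a * Real.sin (θ / 2) ^ b *
      (polarPoly p q k r₀ j).eval (Real.cos (θ / 2) ^ 2) := by
  rw [coeff_genPoly]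
  have hsub : (Finset.range (j + 1)).image (r₀ + ·) ⊆ Finset.range (k + 1) := by
    intro r hr
    simp only [Finset.mem_image, Finset.mem_range] at hr ⊢
    omega
  rw [← Finset.sum_subset hsub, Finset.sum_image (by intro x _ y _ h; simpa using h), polarPoly,
    eval_finsetSum, Finset.mul_sum]
  · refine Finset.sum_congr rfl fun i hi => ?_
    rw [Finset.mem_range] at hi
    simp only [eval_mul, eval_C, eval_pow, eval_X, eval_sub, eval_one]
    rw [← Real.sin_sq, ← pow_mul, ← pow_mul, neg_pow (Real.sin (θ / 2))]
    have e1 : Real.cos (θ / 2) ^ (r₀ + i) * Real.cos (θ / 2) ^ (q - (k - (r₀ + i))) =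
        Real.cos (θ / 2) ^ a * Real.cos (θ / 2) ^ (2 * i) := by
      rw [← pow_add, ← pow_add]; congr 1; omega
    have e2 : Real.sin (θ / 2) ^ (p - (r₀ + i)) * Real.sin (θ / 2) ^ (k - (r₀ + i)) =
        Real.sin (θ / 2) ^ b * Real.sin (θ / 2) ^ (2 * (j - i)) := by
      rw [← pow_add, ← pow_add]; congr 1; omega
    generalize Real.cos (θ / 2) ^ (r₀ + i) = x1 at *
    generalize Real.cos (θ / 2) ^ (q - (k - (r₀ + i))) = x2 at *
    generalize Real.sin (θ / 2) ^ (p - (r₀ + i)) = x3 at *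
    generalize Real.sin (θ / 2) ^ (k - (r₀ + i)) = x4 at *
    calc _ = (-1) ^ (p - (r₀ + i)) * (p.choose (r₀ + i) : ℝ) * (q.choose (k - (r₀ + i)) : ℝ) *
          (x1 * x2) * (x3 * x4) := by ring
      _ = _ := by rw [e1, e2]; ring
  · intro r hr hr'
    simp only [Finset.mem_image, Finset.mem_range, not_exists, not_and] at hr hr'
    by_cases h6 : r < r₀
    · rw [Nat.choose_eq_zero_of_lt (n := q) (by omega)]; simp
    · have : r₀ + j < r := by
        by_contra h7
        exact hr' (r - r₀) (by omega) (by omega)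
      rw [Nat.choose_eq_zero_of_lt (n := p) (by omega)]; simp

theorem polarY_eq_polynomial (s m : ℤ) : ∃ a b : ℕ, ∀ j : ℕ, ∃ Q : ℝ[X], Q.degree = j ∧
    ∀ θ, polarY (max |s| |m| + j) s m θ =
      Real.cos (θ / 2) ^ a * Real.sin (θ / 2) ^ b * Q.eval (Real.cos (θ / 2) ^ 2) := by
  refine ⟨|m - s|.toNat, |m + s|.toNat, fun j => ?_⟩
  set l : ℤ := max |s| |m| + j with hl
  have hs : |s| ≤ l := by omega
  have hm : |m| ≤ l := by omega
  have hl0 : 0 ≤ l := (abs_nonneg s).trans hs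
  have as := abs_cases s
  have am := abs_cases m
  have ams := abs_cases (m - s)
  have ams' := abs_cases (m + s)
  set κ := alm l m / Real.sqrt (((l + s).toNat.factorial : ℝ) * ((l - s).toNat.factorial : ℝ))
  have hκ : κ ≠ 0 := by
    have := alm_pos (m := m) hl0
    positivity
  refine ⟨C κ * polarPoly (l - s).toNat (l + s).toNat (l + m).toNat (m - s).toNat j, ?_, ?_⟩
  · rw [degree_C_mul hκ, degree_polarPoly] <;> omega
  · intro θ
    rw [polarY, if_pos ⟨hs, hm⟩, coeff_genPoly_eq_polarPoly (a := |m - s|.toNat)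
      (b := |m + s|.toNat) (r₀ := (m - s).toNat) (j := j), eval_mul, eval_C]
    · ring
    all_goals omega

end coeff

theorem sum_Icc_int_eq_sum_range {M : Type*} [AddCommMonoid M] (F : ℤ → M) (n : ℕ) :
    ∑ r ∈ Finset.Icc (0 : ℤ) n, F r = ∑ r ∈ Finset.range (n + 1), F r := by
  refine Finset.sum_nbij' Int.toNat (fun r : ℕ => (r : ℤ)) ?_ ?_ ?_ ?_ ?_
  · intro r hr; rw [Finset.mem_Icc] at hr; rw [Finset.mem_range]; omega
  · intro r hr; rw [Finset.mem_range] at hr; rw [Finset.mem_Icc]; omega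
  · intro r hr; rw [Finset.mem_Icc] at hr; omega
  · intro r _; simp
  · intro r hr; rw [Finset.mem_Icc] at hr; rw [Int.toNat_of_nonneg hr.1]

theorem izbinom_natCast (n j : ℕ) : izbinom n j = n.choose j := by
  rw [izbinom]
  split_ifs with h
  · simp
  · rw [Nat.choose_eq_zero_of_lt]; omega

theorem sum_izbinom_eq_coeff_genPoly {p q k : ℕ} {l s m : ℤ} (hp : l - s = p) (hq : l + s = q)
    (hk : l + m = k) {θ : ℝ} (hθ : Real.sin (θ / 2) ≠ 0) :
    ((Real.sin (θ / 2) : ℂ)) ^ (2 * l) *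
    ∑ r ∈ Finset.Icc (0 : ℤ) (l - s),
      (izbinom (l - s) r : ℂ) * (izbinom (l + s) (r + s - m) : ℂ) * (-1 : ℂ) ^ (l - r - s) *
        ((Real.cos (θ / 2) / Real.sin (θ / 2) : ℝ) : ℂ) ^ (2 * r + s - m) =
    ((genPoly p q θ).coeff k : ℂ) := by
  rw [hp, sum_Icc_int_eq_sum_range, coeff_genPoly, Finset.mul_sum, Complex.ofReal_sum]
  set c := Real.cos (θ / 2)
  set σ := Real.sin (θ / 2)
  have hσ : (σ : ℂ) ≠ 0 := by exact_mod_cast hθ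
  set F : ℕ → ℂ := fun r => (σ : ℂ) ^ (2 * l) *
      ((izbinom p r : ℂ) * (izbinom (l + s) (r + s - m) : ℂ) * (-1 : ℂ) ^ (l - r - s) *
        ((c / σ : ℝ) : ℂ) ^ (2 * (r : ℤ) + s - m))
  set G : ℕ → ℂ := fun r => ((c ^ r * (-σ) ^ (p - r) * (p.choose r) *
    (σ ^ (k - r) * c ^ (q - (k - r)) * (q.choose (k - r))) : ℝ) : ℂ)
  set t := (Finset.range (p + 1)) ∩ (Finset.range (k + 1)) with ht
  have hF : ∑ r ∈ Finset.range (p + 1), F r = ∑ r ∈ t, F r := by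
    symm
    refine Finset.sum_subset Finset.inter_subset_left fun r h1 h2 => ?_
    simp only [ht, Finset.mem_inter, Finset.mem_range] at h1 h2
    simp only [F]
    rw [izbinom.eq_1 (l + s), if_neg (by omega)]
    simp
  have hG : ∑ r ∈ Finset.range (k + 1), G r = ∑ r ∈ t, G r := by
    symm
    refine Finset.sum_subset Finset.inter_subset_right fun r h1 h2 => ?_
    simp only [ht, Finset.mem_inter, Finset.mem_range] at h1 h2
    simp only [G]
    rw [Nat.choose_eq_zero_of_lt (n := p) (by omega)]
    simp
  rw [hF, hG]
  refine Finset.sum_congr rfl fun r hr => ?_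
  simp only [ht, Finset.mem_inter, Finset.mem_range] at hr
  simp only [F, G]
  by_cases h : k - r ≤ q
  · have e1 : (r : ℤ) + s - m = ((q - (k - r) : ℕ) : ℤ) := by omega
    have e2 : 2 * (r : ℤ) + s - m = ((r + (q - (k - r)) : ℕ) : ℤ) := by omega
    have e3 : l - r - s = ((p - r : ℕ) : ℤ) := by omega
    have e4 : 2 * l = ((r + (q - (k - r)) + ((p - r) + (k - r)) : ℕ) : ℤ) := by omega
    rw [e1, e2, e3, e4, hq, izbinom_natCast, izbinom_natCast, Nat.choose_symm h]
    rw [zpow_natCast, zpow_natCast, zpow_natCast]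
    push_cast
    rw [div_pow, neg_pow (σ : ℂ)]
    field_simp
    ring
  · rw [izbinom.eq_1 (l + s), if_neg (by omega), Nat.choose_eq_zero_of_lt (n := q) (by omega)]
    simp

theorem sY_eq {s l m : ℤ} (hs : |s| ≤ l) (hm : |m| ≤ l) {θ : ℝ} (h0 : 0 < θ) (hπ : θ < Real.pi)
    (φ : ℝ) : sY s l m (θ, φ) = Complex.exp (Complex.I * (m : ℂ) * (φ : ℂ)) *
      (-1 : ℂ) ^ (max (-m) 0) * (polarY l s m θ : ℂ) := by
  have h1 := abs_le.1 hs
  have h2 := abs_le.1 hm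
  have hσ : Real.sin (θ / 2) ≠ 0 := (Real.sin_pos_of_pos_of_lt_pi (by linarith) (by linarith)).ne'
  rw [sY, mul_assoc _ _ (Finset.sum _ _), sum_izbinom_eq_coeff_genPoly (p := (l - s).toNat)
    (q := (l + s).toNat) (k := (l + m).toNat) (by omega) (by omega) (by omega) hσ, polarY,
    if_pos ⟨hs, hm⟩]
  push_cast
  ring

/-- Continuity and boundedness on `(0, π)`. -/
def BddCont (h : ℝ → ℂ) : Prop :=
  ContinuousOn h (Set.Ioo 0 Real.pi) ∧ ∃ M : ℝ, ∀ θ ∈ Set.Ioo 0 Real.pi, ‖h θ‖ ≤ M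

namespace BddCont

theorem mul {h g : ℝ → ℂ} (hh : BddCont h) (hg : BddCont g) : BddCont (fun θ => h θ * g θ) := by
  obtain ⟨M, hM⟩ := hh.2
  obtain ⟨N, hN⟩ := hg.2
  refine ⟨hh.1.mul hg.1, M * N, fun θ hθ => ?_⟩
  rw [norm_mul]
  exact mul_le_mul (hM θ hθ) (hN θ hθ) (norm_nonneg _) ((norm_nonneg _).trans (hM θ hθ))

theorem sub {h g : ℝ → ℂ} (hh : BddCont h) (hg : BddCont g) : BddCont (fun θ => h θ - g θ) := by
  obtain ⟨M, hM⟩ := hh.2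
  obtain ⟨N, hN⟩ := hg.2
  exact ⟨hh.1.sub hg.1, M + N, fun θ hθ =>
    (norm_sub_le _ _).trans (add_le_add (hM θ hθ) (hN θ hθ))⟩

theorem of_continuous {h : ℝ → ℂ} (hh : Continuous h) : BddCont h := by
  obtain ⟨M, hM⟩ := isCompact_Icc.exists_bound_of_continuousOn (s := Set.Icc 0 Real.pi)
    hh.continuousOn
  exact ⟨hh.continuousOn, M, fun θ hθ => hM θ (Set.Ioo_subset_Icc_self hθ)⟩

theorem intervalIntegrable {h : ℝ → ℂ} (hh : BddCont h) :
    IntervalIntegrable h MeasureTheory.volume 0 Real.pi := by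
  obtain ⟨M, hM⟩ := hh.2
  rw [intervalIntegrable_iff_integrableOn_Ioo_of_le Real.pi_pos.le]
  refine MeasureTheory.IntegrableOn.of_bound (by simp)
    (hh.1.aestronglyMeasurable measurableSet_Ioo) M ?_
  exact (MeasureTheory.ae_restrict_iff' measurableSet_Ioo).2 (Filter.Eventually.of_forall hM)

theorem continuousOn_sin_mul {h : ℝ → ℂ} (hh : BddCont h) :
    ContinuousOn (fun θ => (Real.sin θ : ℂ) * h θ) (Set.Icc 0 Real.pi) := by
  obtain ⟨M, hM⟩ := hh.2
  have hs : Continuous fun θ : ℝ => (Real.sin θ : ℂ) := by fun_prop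
  have hend : ∀ θ₀, Real.sin θ₀ = 0 → ContinuousWithinAt (fun θ => (Real.sin θ : ℂ) * h θ)
      (Set.Icc 0 Real.pi) θ₀ := by
    intro θ₀ h0
    rw [ContinuousWithinAt, h0, Complex.ofReal_zero, zero_mul]
    have hlim : Filter.Tendsto (fun θ : ℝ => |Real.sin θ| * |M|)
        (nhdsWithin θ₀ (Set.Icc 0 Real.pi)) (nhds 0) := by
      have : Continuous fun θ : ℝ => |Real.sin θ| * |M| := by fun_prop
      simpa [h0] using (this.tendsto θ₀).mono_left nhdsWithin_le_nhds
    refine squeeze_zero_norm' ?_ hlim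
    filter_upwards [self_mem_nhdsWithin] with θ hθ
    rw [norm_mul, Complex.norm_real, Real.norm_eq_abs]
    by_cases h1 : θ ∈ Set.Ioo 0 Real.pi
    · exact mul_le_mul_of_nonneg_left ((hM θ h1).trans (le_abs_self M)) (abs_nonneg _)
    · have : θ = 0 ∨ θ = Real.pi := by
        simp only [Set.mem_Ioo, not_and_or, not_lt] at h1
        exact h1.imp (fun h => le_antisymm h hθ.1) (fun h => le_antisymm hθ.2 h)
      rcases this with rfl | rfl <;> simp
  intro θ hθ
  by_cases h1 : θ ∈ Set.Ioo 0 Real.pi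
  · exact (hs.continuousAt.mul (hh.1.continuousAt (isOpen_Ioo.mem_nhds h1))).continuousWithinAt
  · have : θ = 0 ∨ θ = Real.pi := by
      simp only [Set.mem_Ioo, not_and_or, not_lt] at h1
      exact h1.imp (fun h => le_antisymm h hθ.1) (fun h => le_antisymm hθ.2 h)
    rcases this with rfl | rfl
    · exact hend _ Real.sin_zero
    · exact hend _ Real.sin_pi

end BddCont

/-- The pairing of a function of `θ` with a polar function, for the weight `sin θ`. -/
def pair (h : ℝ → ℂ) (l s m : ℤ) : ℂ :=
  ∫ θ in (0 : ℝ)..Real.pi, h θ * (polarY l s m θ : ℂ) * (Real.sin θ : ℂ)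

theorem bddCont_polarY (l s m : ℤ) : BddCont fun θ => (polarY l s m θ : ℂ) :=
  BddCont.of_continuous (Complex.continuous_ofReal.comp (continuous_polarY l s m))

theorem bddCont_sin : BddCont fun θ => (Real.sin θ : ℂ) :=
  BddCont.of_continuous (by fun_prop)

theorem BddCont.intervalIntegrable_pair {h : ℝ → ℂ} (hh : BddCont h) (l s m : ℤ) :
    IntervalIntegrable (fun θ => h θ * (polarY l s m θ : ℂ) * (Real.sin θ : ℂ))
      MeasureTheory.volume 0 Real.pi :=
  ((hh.mul (bddCont_polarY l s m)).mul bddCont_sin).intervalIntegrable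

theorem integral_mul_sin_of_ladder {h h' h₁ : ℝ → ℂ} {v v' w μ : ℝ → ℝ} {c : ℝ}
    (hh : BddCont h) (hh₁ : BddCont h₁) (hd : ∀ θ ∈ Set.Ioo 0 Real.pi, HasDerivAt h (h' θ) θ)
    (hode : ∀ θ ∈ Set.Ioo 0 Real.pi, Real.sin θ * h' θ = μ θ * h θ - Real.sin θ * h₁ θ)
    (hv : ∀ θ, HasDerivAt v (v' θ) θ) (hw : Continuous w)
    (hvode : ∀ θ, Real.sin θ * v' θ = -(μ θ + Real.cos θ) * v θ + c * Real.sin θ * w θ) :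
    ∫ θ in (0 : ℝ)..Real.pi, h₁ θ * (v θ : ℂ) * (Real.sin θ : ℂ) =
      c * ∫ θ in (0 : ℝ)..Real.pi, h θ * (w θ : ℂ) * (Real.sin θ : ℂ) := by
  have hvc : BddCont fun θ => (v θ : ℂ) := BddCont.of_continuous
    (Complex.continuous_ofReal.comp (continuous_iff_continuousAt.2 fun θ => (hv θ).continuousAt))
  have hwc : BddCont fun θ => (w θ : ℂ) :=
    BddCont.of_continuous (Complex.continuous_ofReal.comp hw)
  have i1 := ((hh.mul hwc).mul bddCont_sin).intervalIntegrable
  have i2 := ((hh₁.mul hvc).mul bddCont_sin).intervalIntegrable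
  have key := intervalIntegral.integral_eq_sub_of_hasDerivAt_of_le Real.pi_pos.le
    (f := fun θ => (Real.sin θ : ℂ) * (h θ * (v θ : ℂ)))
    (f' := fun θ => (c : ℂ) * (h θ * (w θ : ℂ) * (Real.sin θ : ℂ)) -
      h₁ θ * (v θ : ℂ) * (Real.sin θ : ℂ))
    ((hh.mul hvc).continuousOn_sin_mul) ?_ ((i1.const_mul _).sub i2)
  · rw [intervalIntegral.integral_sub (i1.const_mul _) i2,
      intervalIntegral.integral_const_mul] at key
    simp only [Real.sin_pi, Real.sin_zero, Complex.ofReal_zero, zero_mul, sub_self] at key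
    exact (sub_eq_zero.1 key).symm
  · intro θ hθ
    refine ((Real.hasDerivAt_sin θ).ofReal_comp.mul ((hd θ hθ).mul (hv θ).ofReal_comp)).congr_deriv ?_
    have e1 := hode θ hθ
    have e2 : (Real.sin θ : ℂ) * v' θ = -(μ θ + Real.cos θ) * v θ + c * Real.sin θ * w θ := by
      exact_mod_cast hvode θ
    simp only [Pi.mul_apply]
    linear_combination (v θ : ℂ) * e1 + h θ * e2

theorem pair_raise {h h' h₁ : ℝ → ℂ} {s m : ℤ} (hh : BddCont h) (hh₁ : BddCont h₁)
    (hd : ∀ θ ∈ Set.Ioo 0 Real.pi, HasDerivAt h (h' θ) θ)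
    (hode : ∀ θ ∈ Set.Ioo 0 Real.pi,
      Real.sin θ * h' θ = (m + s * Real.cos θ) * h θ - Real.sin θ * h₁ θ) (l : ℤ) :
    pair h₁ l (s + 1) m = ladder l (s + 1) * pair h l s m := by
  refine integral_mul_sin_of_ladder (μ := fun θ => m + s * Real.cos θ) hh hh₁ hd ?_
    (hasDerivAt_polarY l (s + 1) m) (continuous_polarY l s m) fun θ => ?_
  · intro θ hθ; rw [hode θ hθ]; push_cast; ring
  · have e := polarY_recurrence l (s + 1) m θ
    rw [show s + 1 - 1 = s by ring] at e ⊢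
    push_cast at e
    linear_combination e

theorem pair_lower {h h' h₁ : ℝ → ℂ} {s m : ℤ} (hh : BddCont h) (hh₁ : BddCont h₁)
    (hd : ∀ θ ∈ Set.Ioo 0 Real.pi, HasDerivAt h (h' θ) θ)
    (hode : ∀ θ ∈ Set.Ioo 0 Real.pi,
      Real.sin θ * h' θ = -(m + s * Real.cos θ) * h θ - Real.sin θ * h₁ θ) (l : ℤ) :
    pair h₁ l (s - 1) m = -ladder l s * pair h l s m := by
  rw [← Complex.ofReal_neg]
  refine integral_mul_sin_of_ladder (μ := fun θ => -(m + s * Real.cos θ)) hh hh₁ hd ?_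
    (hasDerivAt_polarY l (s - 1) m) (continuous_polarY l s m) fun θ => ?_
  · intro θ hθ; rw [hode θ hθ]; push_cast; ring
  · have e := polarY_recurrence l (s - 1) m θ
    rw [show s - 1 + 1 = s by ring] at e ⊢
    push_cast at e
    linear_combination (-1 : ℝ) * e

theorem pair_polarY_comm (l l' s m : ℤ) :
    pair (fun θ => (polarY l s m θ : ℂ)) l' s m = pair (fun θ => (polarY l' s m θ : ℂ)) l s m := by
  rw [pair, pair]
  congr 1
  funext θ
  ring

theorem ladder_mul_pair_polarY (l l' s m : ℤ) :
    ladder l (s + 1) * pair (fun θ => (polarY l (s + 1) m θ : ℂ)) l' (s + 1) m =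
      ladder l' (s + 1) * pair (fun θ => (polarY l s m θ : ℂ)) l' s m := by
  rw [← pair_raise (h := fun θ => (polarY l s m θ : ℂ))
    (h₁ := fun θ => (ladder l (s + 1) : ℂ) * (polarY l (s + 1) m θ : ℂ)) (bddCont_polarY l s m)
    ((BddCont.of_continuous continuous_const).mul (bddCont_polarY l (s + 1) m))
    (fun θ _ => (hasDerivAt_polarY l s m θ).ofReal_comp) ?_ l', pair, pair,
    ← intervalIntegral.integral_const_mul]
  · congr 1; funext θ; ring
  · intro θ _
    have e : ((m : ℂ) + s * Real.cos θ) * polarY l s m θ = Real.sin θ *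
      ((ladder l (s + 1) * polarY l (s + 1) m θ + ladder l s * polarY l (s - 1) m θ) / 2) := by
      exact_mod_cast polarY_recurrence l s m θ
    rw [e]; push_cast; ring

theorem pair_polarY_of_ne {l l' s : ℤ} (m : ℤ) (hl : |s| ≤ l) (hl' : |s| ≤ l') (hne : l ≠ l') :
    pair (fun θ => (polarY l s m θ : ℂ)) l' s m = 0 := by
  have h1 := ladder_mul_pair_polarY l l' s m
  have h2 := ladder_mul_pair_polarY l' l s m
  rw [pair_polarY_comm l' l s m, pair_polarY_comm l' l (s + 1) m] at h2
  have a1 := abs_le.1 hl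
  have a2 := abs_le.1 hl'
  have q1 := ladder_sq (l := l) (s := s + 1) (by omega) (by omega)
  have q2 := ladder_sq (l := l') (s := s + 1) (by omega) (by omega)
  have h3 : ((ladder l' (s + 1) ^ 2 - ladder l (s + 1) ^ 2 : ℝ) : ℂ) *
      pair (fun θ => (polarY l s m θ : ℂ)) l' s m = 0 := by
    push_cast
    linear_combination ((ladder l (s + 1) : ℝ) : ℂ) * h2 - ((ladder l' (s + 1) : ℝ) : ℂ) * h1
  refine (mul_eq_zero.1 h3).resolve_left ?_
  rw [Complex.ofReal_eq_zero, q1, q2]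
  have h4 : (l' - l) * (l' + l + 1) ≠ 0 := mul_ne_zero (by omega) (by
    have := abs_nonneg s; omega)
  have h5 : (((l' - l) * (l' + l + 1) : ℤ) : ℝ) ≠ 0 := by exact_mod_cast h4
  intro h6
  apply h5
  push_cast at h6 ⊢
  linear_combination h6

theorem pair_polarY_self {l s m : ℤ} (hs : |s| ≤ l) (hm : |m| ≤ l) :
    pair (fun θ => (polarY l s m θ : ℂ)) l s m = 1 / (2 * Real.pi) := by
  have hl0 : 0 ≤ l := (abs_nonneg s).trans hs
  have a1 := abs_le.1 hs
  set J : ℕ → ℂ := fun j => pair (fun θ => (polarY l (-l + j) m θ : ℂ)) l (-l + j) m with hJ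
  have hstep : ∀ j : ℕ, j < 2 * l → J (j + 1) = J j := by
    intro j hj
    have h1 := ladder_mul_pair_polarY l l (-l + j) m
    have q1 := ladder_sq (l := l) (s := -l + j + 1) (by omega) (by omega)
    have hpos : ladder l (-l + j + 1) ≠ 0 := by
      intro h0
      rw [h0] at q1
      have hj' : (j : ℝ) < 2 * l := by exact_mod_cast hj
      push_cast at q1
      have : (0 : ℝ) < ((l : ℝ) + (-l + j + 1)) * ((l : ℝ) - (-l + j + 1) + 1) :=
        mul_pos (by linarith [Nat.cast_nonneg (α := ℝ) j]) (by linarith)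
      linarith
    simp only [hJ]
    push_cast
    rw [← add_assoc]
    exact mul_left_cancel₀ (by exact_mod_cast hpos) h1
  have hJ0 : ∀ j : ℕ, j ≤ 2 * l → J j = J 0 := by
    intro j
    induction j with
    | zero => intro _; rfl
    | succ j ih => intro h; rw [hstep j (by omega), ih (by omega)]
  have hsum : ∑ j ∈ Finset.range (2 * l + 1).toNat, J j = (2 * (l : ℂ) + 1) / (2 * Real.pi) := by
    simp only [hJ, pair]
    rw [← intervalIntegral.integral_finsetSum fun (j : ℕ) _ =>
      (bddCont_polarY l (-l + j) m).intervalIntegrable_pair l (-l + j) m]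
    have : ∀ θ : ℝ, ∑ j ∈ Finset.range (2 * l + 1).toNat, (polarY l (-l + j) m θ : ℂ) *
        (polarY l (-l + j) m θ : ℂ) * (Real.sin θ : ℂ) =
        (((2 * (l : ℝ) + 1) / (4 * Real.pi) * Real.sin θ : ℝ) : ℂ) := by
      intro θ
      rw [← sum_sq_polarY l m hm θ, Finset.sum_mul, Complex.ofReal_sum]
      refine Finset.sum_congr rfl fun j _ => ?_
      push_cast; ring
    simp only [this]
    rw [intervalIntegral.integral_ofReal, intervalIntegral.integral_const_mul, integral_sin]
    have := Real.pi_ne_zero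
    have : (Real.pi : ℂ) ≠ 0 := by exact_mod_cast this
    simp only [Real.cos_zero, Real.cos_pi]
    push_cast
    field_simp
    ring
  rw [Finset.sum_congr rfl fun j hj => hJ0 j (by rw [Finset.mem_range] at hj; omega),
    Finset.sum_const, Finset.card_range, nsmul_eq_mul] at hsum
  have e1 : (((2 * l + 1).toNat : ℕ) : ℂ) = 2 * l + 1 := by
    have : (((2 * l + 1).toNat : ℕ) : ℤ) = 2 * l + 1 := Int.toNat_of_nonneg (by omega)
    exact_mod_cast congrArg (fun z : ℤ => (z : ℂ)) this
  rw [e1] at hsum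
  have hne : (2 * (l : ℂ) + 1) ≠ 0 := by
    have : (2 * l + 1 : ℤ) ≠ 0 := by omega
    exact_mod_cast this
  have h2 := hJ0 (l + s).toNat (by omega)
  have e2 : -l + ((l + s).toNat : ℤ) = s := by omega
  simp only [hJ, e2] at h2
  rw [h2]
  refine mul_left_cancel₀ hne ?_
  rw [hsum]; ring

theorem integral_mul_eq_zero_of_moments {K : ℝ → ℂ} (hK : ContinuousOn K (Set.Icc 0 Real.pi))
    (hmom : ∀ P : Polynomial ℝ,
      ∫ θ in (0 : ℝ)..Real.pi, K θ * ((P.eval (Real.cos (θ / 2) ^ 2) : ℝ) : ℂ) = 0)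
    {ψ : ℝ → ℝ} (hψ : ContinuousOn ψ (Set.Icc 0 Real.pi)) :
    ∫ θ in (0 : ℝ)..Real.pi, K θ * (ψ θ : ℂ) = 0 := by
  have hu : Set.uIcc 0 Real.pi = Set.Icc 0 Real.pi := Set.uIcc_of_le Real.pi_pos.le
  obtain ⟨M, hM⟩ := isCompact_Icc.exists_bound_of_continuousOn hK
  have hψ' : ContinuousOn (fun w => ψ (Real.arccos (2 * w - 1))) (Set.Icc 0 1) :=
    hψ.comp (by fun_prop) fun w _ => ⟨Real.arccos_nonneg _, Real.arccos_le_pi _⟩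
  rw [← norm_le_zero_iff]
  refine le_of_forall_pos_le_add fun ε hε => ?_
  have hM0 : 0 ≤ M := (norm_nonneg _).trans (hM 0 ⟨le_rfl, Real.pi_pos.le⟩)
  set δ := ε / (M * Real.pi + 1) with hδ
  have hδ0 : 0 < δ := by have := Real.pi_pos; positivity
  obtain ⟨P, hP⟩ := exists_polynomial_near_of_continuousOn 0 1 _ hψ' δ hδ0
  have hPc : Continuous fun θ : ℝ => ((P.eval (Real.cos (θ / 2) ^ 2) : ℝ) : ℂ) := by
    have := P.continuous; fun_prop
  have hi1 : IntervalIntegrable (fun θ => K θ * (ψ θ : ℂ)) MeasureTheory.volume 0 Real.pi :=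
    ContinuousOn.intervalIntegrable (by
      rw [hu]; exact hK.mul (Complex.continuous_ofReal.comp_continuousOn hψ))
  have hi2 : IntervalIntegrable (fun θ => K θ * ((P.eval (Real.cos (θ / 2) ^ 2) : ℝ) : ℂ))
      MeasureTheory.volume 0 Real.pi :=
    ContinuousOn.intervalIntegrable (by rw [hu]; exact hK.mul hPc.continuousOn)
  rw [← sub_zero (∫ θ in (0 : ℝ)..Real.pi, K θ * (ψ θ : ℂ)), ← hmom P,
    ← intervalIntegral.integral_sub hi1 hi2]
  have hb := intervalIntegral.norm_integral_le_of_norm_le_const (a := 0) (b := Real.pi)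
    (f := fun θ => K θ * (ψ θ : ℂ) - K θ * ((P.eval (Real.cos (θ / 2) ^ 2) : ℝ) : ℂ))
    (C := M * δ) ?_
  · refine hb.trans ?_
    rw [sub_zero, abs_of_pos Real.pi_pos, zero_add, hδ]
    have := Real.pi_pos
    rw [mul_right_comm, mul_div_assoc', div_le_iff₀ (by positivity)]
    nlinarith
  · intro θ hθ
    rw [Set.uIoc_of_le Real.pi_pos.le] at hθ
    have hθ' : θ ∈ Set.Icc 0 Real.pi := ⟨hθ.1.le, hθ.2⟩
    rw [← mul_sub, norm_mul, ← Complex.ofReal_sub, Complex.norm_real, Real.norm_eq_abs, abs_sub_comm]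
    refine mul_le_mul (hM θ hθ') ?_ (abs_nonneg _) hM0
    have h1 := hP (Real.cos (θ / 2) ^ 2) ⟨sq_nonneg _, Real.cos_sq_le_one _⟩
    have h2 : 2 * Real.cos (θ / 2) ^ 2 - 1 = Real.cos θ := by
      rw [← Real.cos_two_mul]; congr 1; ring
    rw [h2, Real.arccos_cos hθ'.1 hθ'.2] at h1
    exact h1.le

theorem eq_zero_of_pair_eq_zero {h : ℝ → ℂ} (hh : BddCont h) {s m : ℤ}
    (h0 : ∀ j : ℕ, pair h (max |s| |m| + j) s m = 0) :
    ∀ θ ∈ Set.Ioo 0 Real.pi, h θ = 0 := by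
  obtain ⟨a, b, hab⟩ := polarY_eq_polynomial s m
  choose Q hQ hQe using hab
  have hu : Set.uIcc 0 Real.pi = Set.Icc 0 Real.pi := Set.uIcc_of_le Real.pi_pos.le
  set K : ℝ → ℂ := fun θ => (Real.sin θ : ℂ) *
    (h θ * ((Real.cos (θ / 2) ^ a * Real.sin (θ / 2) ^ b : ℝ) : ℂ)) with hKdef
  have hK : ContinuousOn K (Set.Icc 0 Real.pi) :=
    (hh.mul (BddCont.of_continuous (by fun_prop))).continuousOn_sin_mul
  have hint : ∀ P : Polynomial ℝ, IntervalIntegrable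
      (fun θ => K θ * ((P.eval (Real.cos (θ / 2) ^ 2) : ℝ) : ℂ)) MeasureTheory.volume 0 Real.pi := by
    intro P
    have hPc : Continuous fun θ : ℝ => ((P.eval (Real.cos (θ / 2) ^ 2) : ℝ) : ℂ) := by
      have := P.continuous; fun_prop
    exact ContinuousOn.intervalIntegrable (by rw [hu]; exact hK.mul hPc.continuousOn)
  let Λ : Polynomial ℝ →ₗ[ℝ] ℂ :=
    { toFun := fun P => ∫ θ in (0 : ℝ)..Real.pi, K θ * ((P.eval (Real.cos (θ / 2) ^ 2) : ℝ) : ℂ)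
      map_add' := fun P P' => by
        rw [← intervalIntegral.integral_add (hint P) (hint P')]
        congr 1; funext θ; rw [Polynomial.eval_add]; push_cast; ring
      map_smul' := fun r P => by
        rw [RingHom.id_apply, ← intervalIntegral.integral_smul]
        congr 1; funext θ
        rw [Polynomial.eval_smul, smul_eq_mul, Complex.real_smul]; push_cast; ring }
  let S : Polynomial.Sequence ℝ := ⟨Q, hQ⟩
  have hspan : Submodule.span ℝ (Set.range S) = ⊤ := S.span fun i =>
    (Polynomial.leadingCoeff_ne_zero.2 (S.ne_zero i)).isUnit
  have hΛ : ∀ P, Λ P = 0 := by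
    intro P
    have hP : P ∈ Submodule.span ℝ (Set.range S) := by rw [hspan]; trivial
    refine (Submodule.span_le.2 ?_ hP : P ∈ LinearMap.ker Λ)
    rintro _ ⟨j, rfl⟩
    change ∫ θ in (0 : ℝ)..Real.pi, K θ * (((Q j).eval (Real.cos (θ / 2) ^ 2) : ℝ) : ℂ) = 0
    rw [← h0 j, pair]
    congr 1; funext θ
    rw [hQe j θ, hKdef]; push_cast; ring
  have hre := integral_mul_eq_zero_of_moments hK hΛ (Complex.continuous_re.comp_continuousOn hK)
  have him := integral_mul_eq_zero_of_moments hK hΛ (Complex.continuous_im.comp_continuousOn hK)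
  have hKre : ContinuousOn (fun θ => K θ * (((K θ).re : ℝ) : ℂ)) (Set.Icc 0 Real.pi) :=
    hK.mul (Complex.continuous_ofReal.comp_continuousOn (Complex.continuous_re.comp_continuousOn hK))
  have hKim : ContinuousOn (fun θ => Complex.I * (K θ * (((K θ).im : ℝ) : ℂ))) (Set.Icc 0 Real.pi) :=
    continuousOn_const.mul (hK.mul (Complex.continuous_ofReal.comp_continuousOn
      (Complex.continuous_im.comp_continuousOn hK)))
  have hsq : ∫ θ in (0 : ℝ)..Real.pi, ‖K θ‖ ^ 2 = 0 := by
    have h1 : ((∫ θ in (0 : ℝ)..Real.pi, ‖K θ‖ ^ 2 : ℝ) : ℂ) =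
        (∫ θ in (0 : ℝ)..Real.pi, K θ * (((K θ).re : ℝ) : ℂ)) -
          Complex.I * ∫ θ in (0 : ℝ)..Real.pi, K θ * (((K θ).im : ℝ) : ℂ) := by
      rw [← intervalIntegral.integral_const_mul, ← intervalIntegral.integral_sub
        (ContinuousOn.intervalIntegrable (by rw [hu]; exact hKre))
        (ContinuousOn.intervalIntegrable (by rw [hu]; exact hKim)), ← intervalIntegral.integral_ofReal]
      congr 1; funext θ
      rw [Complex.sq_norm, Complex.normSq_apply]
      apply Complex.ext <;> simp
      ring
    simp only [Function.comp_apply] at hre him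
    rw [hre, him] at h1
    simpa using h1
  intro θ hθ
  by_contra hne
  have hpos := intervalIntegral.integral_pos Real.pi_pos (f := fun θ => ‖K θ‖ ^ 2) (by fun_prop)
    (fun x _ => by positivity) ⟨θ, Set.Ioo_subset_Icc_self hθ, ?_⟩
  · exact hpos.ne' hsq
  · have h1 : Real.sin θ ≠ 0 := (Real.sin_pos_of_pos_of_lt_pi hθ.1 hθ.2).ne'
    have h2 : Real.sin (θ / 2) ≠ 0 :=
      (Real.sin_pos_of_pos_of_lt_pi (by linarith [hθ.1]) (by linarith [hθ.2, Real.pi_pos])).ne'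
    have h3 : Real.cos (θ / 2) ≠ 0 :=
      (Real.cos_pos_of_mem_Ioo ⟨by linarith [hθ.1, Real.pi_pos], by linarith [hθ.2]⟩).ne'
    have : K θ ≠ 0 := by
      simp only [hKdef]
      refine mul_ne_zero (by exact_mod_cast h1) (mul_ne_zero hne ?_)
      exact_mod_cast mul_ne_zero (pow_ne_zero _ h3) (pow_ne_zero _ h2)
    positivity

/-- `u` has a smooth representative of spin weight `s` near the north pole, in the stereographic
coordinate `tan (θ/2) e^{iφ}`. -/
def North (s : ℤ) (u : ℝ × ℝ → ℂ) : Prop :=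
  ∃ F : ℂ → ℂ, ContDiff ℝ (⊤ : ℕ∞) F ∧ ∀ θ ∈ Set.Ioo 0 Real.pi, ∀ φ : ℝ,
    u (θ, φ) = Complex.exp (-(Complex.I * s * φ)) *
      F ((Real.tan (θ / 2) : ℂ) * Complex.exp (Complex.I * φ))

def polarFlip (u : ℝ × ℝ → ℂ) (x : ℝ × ℝ) : ℂ := u (Real.pi - x.1, x.2)

def Spin (s : ℤ) (u : ℝ × ℝ → ℂ) : Prop := North s u ∧ North (-s) (polarFlip u)

/-- The eth operator (`ε = 1`) and its conjugate (`ε = -1`) acting on spin weight `s`. -/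
def edth (ε s : ℤ) (u : ℝ × ℝ → ℂ) (x : ℝ × ℝ) : ℂ :=
  -(pdθ u x + ε * Complex.I / Real.sin x.1 * pdφ u x -
    ε * s * (Real.cos x.1 / Real.sin x.1) * u x)

theorem half_mem {θ : ℝ} (hθ : θ ∈ Set.Ioo 0 Real.pi) :
    0 < Real.cos (θ / 2) ∧ 0 < Real.sin (θ / 2) :=
  ⟨Real.cos_pos_of_mem_Ioo ⟨by linarith [hθ.1, hθ.2], by linarith [hθ.2]⟩,
    Real.sin_pos_of_pos_of_lt_pi (by linarith [hθ.1]) (by linarith [hθ.1, hθ.2])⟩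

theorem hasDerivAt_tan_half {θ : ℝ} (hθ : θ ∈ Set.Ioo 0 Real.pi) :
    HasDerivAt (fun t : ℝ => Real.tan (t / 2)) ((1 + Real.tan (θ / 2) ^ 2) / 2) θ := by
  have h := (Real.hasDerivAt_tan (half_mem hθ).1.ne').comp θ ((hasDerivAt_id θ).div_const 2)
  refine h.congr_deriv ?_
  have := (half_mem hθ).1.ne'
  rw [Real.tan_eq_sin_div_cos]
  field_simp
  linarith [Real.sin_sq_add_cos_sq (θ / 2)]

theorem sin_cos_tan_half {θ : ℝ} (hθ : θ ∈ Set.Ioo 0 Real.pi) :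
    0 < Real.tan (θ / 2) ∧ Real.sin θ = 2 * Real.tan (θ / 2) / (1 + Real.tan (θ / 2) ^ 2) ∧
      Real.cos θ = (1 - Real.tan (θ / 2) ^ 2) / (1 + Real.tan (θ / 2) ^ 2) := by
  obtain ⟨hc, hs⟩ := half_mem hθ
  have e := Real.sin_sq_add_cos_sq (θ / 2)
  have hne : Real.cos (θ / 2) ^ 2 + Real.sin (θ / 2) ^ 2 ≠ 0 := by
    rw [add_comm, e]; exact one_ne_zero
  have h1 := Real.sin_two_mul (θ / 2)
  have h2 := Real.cos_two_mul (θ / 2)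
  rw [show 2 * (θ / 2) = θ by ring] at h1 h2
  rw [Real.tan_eq_sin_div_cos, h1, h2]
  refine ⟨div_pos hs hc, ?_, ?_⟩
  · field_simp
    rw [show Real.cos (θ / 2) ^ 2 + Real.sin (θ / 2) ^ 2 = 1 by linarith]
  · field_simp
    rw [show Real.cos (θ / 2) ^ 2 + Real.sin (θ / 2) ^ 2 = 1 by linarith]
    linarith

theorem clm_ofReal_mul (L : ℂ →L[ℝ] ℂ) (a : ℝ) (z : ℂ) : L (a * z) = a * L z := by
  rw [← Complex.real_smul, map_smul, Complex.real_smul]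

theorem hasDerivAt_north_theta {F : ℂ → ℂ} (hF : ContDiff ℝ (⊤ : ℕ∞) F) (s : ℤ) {θ : ℝ}
    (hθ : θ ∈ Set.Ioo 0 Real.pi) (φ : ℝ) :
    HasDerivAt (fun t : ℝ => Complex.exp (-(Complex.I * s * φ)) *
      F ((Real.tan (t / 2) : ℂ) * Complex.exp (Complex.I * φ)))
      (Complex.exp (-(Complex.I * s * φ)) * ((((1 + Real.tan (θ / 2) ^ 2) / 2 : ℝ) : ℂ) *
        fderiv ℝ F ((Real.tan (θ / 2) : ℂ) * Complex.exp (Complex.I * φ))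
          (Complex.exp (Complex.I * φ)))) θ := by
  have h1 := ((hasDerivAt_tan_half hθ).ofReal_comp).mul_const (Complex.exp (Complex.I * φ))
  have h2 := (hF.differentiable (by simp) _).hasFDerivAt.comp_hasDerivAt θ h1
  refine (h2.const_mul _).congr_deriv ?_
  rw [clm_ofReal_mul]

theorem hasDerivAt_north_phi {F : ℂ → ℂ} (hF : ContDiff ℝ (⊤ : ℕ∞) F) (s : ℤ) (θ φ : ℝ) :
    HasDerivAt (fun t : ℝ => Complex.exp (-(Complex.I * s * t)) *
      F ((Real.tan (θ / 2) : ℂ) * Complex.exp (Complex.I * t)))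
      (Complex.exp (-(Complex.I * s * φ)) * ((Real.tan (θ / 2) : ℂ) *
        fderiv ℝ F ((Real.tan (θ / 2) : ℂ) * Complex.exp (Complex.I * φ))
          (Complex.I * Complex.exp (Complex.I * φ)) - Complex.I * s *
        F ((Real.tan (θ / 2) : ℂ) * Complex.exp (Complex.I * φ)))) φ := by
  have hlin : ∀ c : ℂ, HasDerivAt (fun t : ℝ => Complex.exp (c * t))
      (Complex.exp (c * φ) * c) φ := fun c => by
    have := ((Complex.ofRealCLM.hasDerivAt (x := φ)).const_mul c).cexp
    simpa using this
  have h1 := (hlin Complex.I).const_mul (Real.tan (θ / 2) : ℂ)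
  have h2 := (hF.differentiable (by simp) _).hasFDerivAt.comp_hasDerivAt φ h1
  have h3 := hlin (-(Complex.I * s))
  simp only [neg_mul] at h3
  refine (h3.mul h2).congr_deriv ?_
  rw [clm_ofReal_mul, mul_comm Complex.I (Complex.exp _)]
  simp only [Function.comp]
  ring

theorem fderiv_apply_basis (L : ℂ →L[ℝ] ℂ) (a b : ℝ) :
    L (a + b * Complex.I) = a * L 1 + b * L Complex.I := by
  rw [map_add, clm_ofReal_mul, ← mul_one (a : ℂ), clm_ofReal_mul, mul_one]

theorem deriv_congr_Ioo {f g : ℝ → ℂ} {a b x : ℝ} (hx : x ∈ Set.Ioo a b)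
    (h : ∀ y ∈ Set.Ioo a b, f y = g y) : deriv f x = deriv g x :=
  Filter.EventuallyEq.deriv_eq (Filter.eventuallyEq_of_mem (Ioo_mem_nhds hx.1 hx.2) h)

theorem North.edth {s ε : ℤ} (hε : ε * ε = 1) {u : ℝ × ℝ → ℂ} (hu : North s u) :
    North (s + ε) (edth ε s u) := by
  obtain ⟨F, hF, hFu⟩ := hu
  refine ⟨fun z => -((((1 + ‖z‖ ^ 2) / 2 : ℝ) : ℂ) *
    (fderiv ℝ F z 1 + ε * Complex.I * fderiv ℝ F z Complex.I) +
    ε * s * ((z.re : ℂ) + ε * Complex.I * z.im) * F z), ?_, ?_⟩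
  · have hd : ContDiff ℝ (⊤ : ℕ∞) (fderiv ℝ F) := hF.fderiv_right (by simp)
    have h1 : ContDiff ℝ (⊤ : ℕ∞) fun z : ℂ => fderiv ℝ F z 1 := hd.clm_apply contDiff_const
    have h2 : ContDiff ℝ (⊤ : ℕ∞) fun z : ℂ => fderiv ℝ F z Complex.I :=
      hd.clm_apply contDiff_const
    have h3 : ContDiff ℝ (⊤ : ℕ∞) fun z : ℂ => (z.re : ℂ) :=
      (Complex.ofRealCLM.comp Complex.reCLM).contDiff
    have h4 : ContDiff ℝ (⊤ : ℕ∞) fun z : ℂ => (z.im : ℂ) :=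
      (Complex.ofRealCLM.comp Complex.imCLM).contDiff
    have h5 : ContDiff ℝ (⊤ : ℕ∞) fun z : ℂ => (((1 + ‖z‖ ^ 2) / 2 : ℝ) : ℂ) :=
      Complex.ofRealCLM.contDiff.comp ((contDiff_const.add (contDiff_norm_sq ℝ)).div_const 2)
    exact ((h5.mul (h1.add (contDiff_const.mul h2))).add
      ((contDiff_const.mul (h3.add (contDiff_const.mul h4))).mul hF)).neg
  · intro θ hθ φ
    obtain ⟨ht, hsin, hcos⟩ := sin_cos_tan_half hθ
    have e1 : pdθ u (θ, φ) = _ :=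
      (deriv_congr_Ioo hθ fun y hy => hFu y hy φ).trans (hasDerivAt_north_theta hF s hθ φ).deriv
    have e2 : pdφ u (θ, φ) = _ :=
      (congrArg (deriv · φ) (funext fun y => hFu θ hθ y)).trans
        (hasDerivAt_north_phi hF s θ φ).deriv
    simp only [_root_.edth]
    rw [e1, e2, hFu θ hθ φ, hsin, hcos]
    set t := Real.tan (θ / 2)
    set z := (t : ℂ) * Complex.exp (Complex.I * φ) with hz
    have hexp : Complex.exp (Complex.I * φ) = Real.cos φ + Real.sin φ * Complex.I := by
      rw [mul_comm, Complex.exp_mul_I, Complex.ofReal_cos, Complex.ofReal_sin]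
    have hIexp : Complex.I * Complex.exp (Complex.I * φ) =
        (-Real.sin φ : ℝ) + Real.cos φ * Complex.I := by
      rw [hexp]; push_cast; linear_combination Complex.sin φ * Complex.I_sq
    have hre : z.re = t * Real.cos φ := by
      rw [hz, Complex.re_ofReal_mul, hexp]; simp [Complex.cos_ofReal_re]
    have him : z.im = t * Real.sin φ := by
      rw [hz, Complex.im_ofReal_mul, hexp]; simp [Complex.sin_ofReal_re]
    have hn : ‖z‖ ^ 2 = t ^ 2 := by
      rw [hz, norm_mul, mul_comm Complex.I, Complex.norm_exp_ofReal_mul_I]; simp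
    have hεφ : Complex.exp (-(Complex.I * ε * φ)) = Real.cos φ - ε * Complex.I * Real.sin φ := by
      rcases mul_self_eq_one_iff.1 hε with rfl | rfl
      · rw [show -(Complex.I * ((1 : ℤ) : ℂ) * φ) = ((-φ : ℝ) : ℂ) * Complex.I by push_cast; ring,
          Complex.exp_mul_I, ← Complex.ofReal_cos, ← Complex.ofReal_sin, Real.cos_neg,
          Real.sin_neg]
        push_cast; ring
      · rw [show -(Complex.I * ((-1 : ℤ) : ℂ) * φ) = (φ : ℂ) * Complex.I by push_cast; ring,
          Complex.exp_mul_I, ← Complex.ofReal_cos, ← Complex.ofReal_sin]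
        push_cast; ring
    have hsplit : Complex.exp (-(Complex.I * ((s + ε : ℤ) : ℂ) * φ)) =
        Complex.exp (-(Complex.I * s * φ)) * Complex.exp (-(Complex.I * ε * φ)) := by
      rw [← Complex.exp_add]; congr 1; push_cast; ring
    rw [hre, him, hn, hsplit, hIexp, hεφ, hexp, fderiv_apply_basis, fderiv_apply_basis]
    set E := Complex.exp (-(Complex.I * s * φ))
    set D₁ := fderiv ℝ F z 1
    set D₂ := fderiv ℝ F z Complex.I
    have hε' : (ε : ℂ) * ε = 1 := by exact_mod_cast hε
    have ht' : (t : ℂ) ≠ 0 := by exact_mod_cast ht.ne'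
    have ht2 : (1 + (t : ℂ) ^ 2) ≠ 0 := by
      have : (1 + t ^ 2 : ℝ) ≠ 0 := by positivity
      exact_mod_cast this
    have hsc : (Real.sin φ : ℂ) ^ 2 + (Real.cos φ : ℂ) ^ 2 = 1 := by
      exact_mod_cast Real.sin_sq_add_cos_sq φ
    have hI := Complex.I_sq
    obtain ⟨q, hq⟩ : ∃ q : ℂ, q = (1 + (t : ℂ) ^ 2) / (2 * t) := ⟨_, rfl⟩
    have hqt : q * t = (1 + (t : ℂ) ^ 2) / 2 := by rw [hq]; field_simp
    have hsinq : (ε : ℂ) * Complex.I / ((2 * t / (1 + t ^ 2) : ℝ) : ℂ) = ε * Complex.I * q := by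
      rw [hq]; push_cast; field_simp
    have hcotq : (((1 - t ^ 2) / (1 + t ^ 2) : ℝ) : ℂ) / ((2 * t / (1 + t ^ 2) : ℝ) : ℂ) = q - t := by
      rw [hq]; push_cast; field_simp; ring
    rw [hsinq, hcotq]
    push_cast at hsc ⊢
    linear_combination (-(ε * Complex.I * E * (-Complex.sin φ * D₁ + Complex.cos φ * D₂))) * hqt +
      (ε * q * E * s * F z - E * ((1 + (t : ℂ) ^ 2) / 2) * Complex.sin φ * D₂ * ε ^ 2 -
        E * ε * s * t * F z * Complex.sin φ ^ 2 * ε ^ 2) * hI +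
      (E * ((1 + (t : ℂ) ^ 2) / 2) * Complex.sin φ * D₂ +
        E * ε * s * t * F z * Complex.sin φ ^ 2) * hε' + E * ε * s * t * F z * hsc

theorem pi_sub_mem {θ : ℝ} (hθ : θ ∈ Set.Ioo 0 Real.pi) : Real.pi - θ ∈ Set.Ioo 0 Real.pi :=
  ⟨by linarith [hθ.2], by linarith [hθ.1]⟩

theorem North.neg {s : ℤ} {u : ℝ × ℝ → ℂ} (hu : North s u) : North s fun x => -u x := by
  obtain ⟨F, hF, hFu⟩ := hu
  exact ⟨fun z => -F z, hF.neg, fun θ hθ φ => by simp only [hFu θ hθ φ, mul_neg]⟩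

theorem polarFlip_edth (ε s : ℤ) (u : ℝ × ℝ → ℂ) :
    polarFlip (edth ε s u) = fun x => -edth (-ε) (-s) (polarFlip u) x := by
  funext x
  have h1 : pdθ (polarFlip u) x = -pdθ u (Real.pi - x.1, x.2) := by
    simp only [pdθ, polarFlip]
    exact deriv_comp_const_sub (f := fun t => u (t, x.2)) Real.pi x.1
  have h2 : pdφ (polarFlip u) x = pdφ u (Real.pi - x.1, x.2) := rfl
  simp only [edth, polarFlip] at h1 h2 ⊢
  simp only [h1, h2, Real.sin_pi_sub, Real.cos_pi_sub]
  push_cast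
  ring

theorem Spin.edth {s ε : ℤ} (hε : ε * ε = 1) {u : ℝ × ℝ → ℂ} (hu : Spin s u) :
    Spin (s + ε) (edth ε s u) := by
  refine ⟨hu.1.edth hε, ?_⟩
  rw [polarFlip_edth, neg_add]
  exact (hu.2.edth (by rw [neg_mul_neg, hε])).neg

theorem North.contDiffOn {s : ℤ} {u : ℝ × ℝ → ℂ} (hu : North s u) :
    ContDiffOn ℝ (⊤ : ℕ∞) u (Set.Ioo 0 Real.pi ×ˢ Set.univ) := by
  obtain ⟨F, hF, hFu⟩ := hu
  have hφ : ContDiff ℝ (⊤ : ℕ∞) fun x : ℝ × ℝ => (x.2 : ℂ) :=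
    Complex.ofRealCLM.contDiff.comp contDiff_snd
  have : ContDiffOn ℝ (⊤ : ℕ∞) (fun x : ℝ × ℝ => Complex.exp (-(Complex.I * s * x.2)) *
      F ((Real.tan (x.1 / 2) : ℂ) * Complex.exp (Complex.I * x.2)))
      (Set.Ioo 0 Real.pi ×ˢ Set.univ) := by
    refine ((contDiff_const.mul hφ).neg.cexp.contDiffOn).mul (hF.comp_contDiffOn ?_)
    refine ContDiffOn.mul ?_ (contDiff_const.mul hφ).cexp.contDiffOn
    refine Complex.ofRealCLM.contDiff.comp_contDiffOn fun x hx => ?_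
    refine ContDiffAt.contDiffWithinAt ?_
    exact (Real.contDiffAt_tan.2 (half_mem hx.1).1.ne').comp x (contDiffAt_fst.div_const 2)
  exact this.congr fun x hx => hFu x.1 hx.1 x.2

theorem North.periodic {s : ℤ} {u : ℝ × ℝ → ℂ} (hu : North s u) {θ : ℝ}
    (hθ : θ ∈ Set.Ioo 0 Real.pi) : Function.Periodic (fun φ => u (θ, φ)) (2 * Real.pi) := by
  obtain ⟨F, hF, hFu⟩ := hu
  intro φ
  simp only [hFu θ hθ]
  congr 1
  · rw [Complex.exp_eq_exp_iff_exists_int]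
    exact ⟨-s, by push_cast; ring⟩
  · congr 2
    rw [Complex.exp_eq_exp_iff_exists_int]
    exact ⟨1, by push_cast; ring⟩

theorem North.bounded {s : ℤ} {u : ℝ × ℝ → ℂ} (hu : North s u) :
    ∃ M : ℝ, ∀ θ ∈ Set.Ioc 0 (Real.pi / 2), ∀ φ : ℝ, ‖u (θ, φ)‖ ≤ M := by
  obtain ⟨F, hF, hFu⟩ := hu
  obtain ⟨M, hM⟩ := (isCompact_closedBall (0 : ℂ) 1).exists_bound_of_continuousOn
    hF.continuous.continuousOn
  refine ⟨M, fun θ hθ φ => ?_⟩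
  have hpi := Real.pi_pos
  have hθ' : θ ∈ Set.Ioo 0 Real.pi := ⟨hθ.1, by linarith [hθ.2]⟩
  have hn : ∀ x : ℝ, ‖Complex.exp (Complex.I * x)‖ = 1 := fun x => by
    rw [mul_comm, Complex.norm_exp_ofReal_mul_I]
  have ht := (sin_cos_tan_half hθ').1
  have ht1 : Real.tan (θ / 2) ≤ 1 := by
    rw [← Real.tan_pi_div_four]
    rcases (show θ / 2 ≤ Real.pi / 4 by linarith [hθ.2]).eq_or_lt with h | h
    · rw [h]
    · exact (Real.tan_lt_tan_of_lt_of_lt_pi_div_two (by linarith [hθ.1]) (by linarith) h).le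
  rw [hFu θ hθ' φ, norm_mul, show -(Complex.I * s * φ) = Complex.I * ((-(s * φ) : ℝ) : ℂ) by
    push_cast; ring, hn, one_mul]
  refine hM _ ?_
  rw [mem_closedBall_zero_iff, norm_mul, hn, mul_one, Complex.norm_real, Real.norm_eq_abs,
    abs_of_pos ht]
  exact ht1

theorem Spin.bounded {s : ℤ} {u : ℝ × ℝ → ℂ} (hu : Spin s u) :
    ∃ M : ℝ, ∀ θ ∈ Set.Ioo 0 Real.pi, ∀ φ : ℝ, ‖u (θ, φ)‖ ≤ M := by
  obtain ⟨M, hM⟩ := hu.1.bounded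
  obtain ⟨M', hM'⟩ := hu.2.bounded
  refine ⟨max M M', fun θ hθ φ => ?_⟩
  rcases le_or_gt θ (Real.pi / 2) with h | h
  · exact (hM θ ⟨hθ.1, h⟩ φ).trans (le_max_left _ _)
  · have := hM' (Real.pi - θ) ⟨by linarith [hθ.2], by linarith⟩ φ
    simp only [polarFlip, sub_sub_cancel] at this
    exact this.trans (le_max_right _ _)

/-- The `m`-th azimuthal Fourier mode. -/
def mode (m : ℤ) (u : ℝ × ℝ → ℂ) (θ : ℝ) : ℂ :=
  ∫ φ in (-Real.pi)..Real.pi, u (θ, φ) * Complex.exp (-(Complex.I * m * φ))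

theorem isOpen_strip : IsOpen (Set.Ioo 0 Real.pi ×ˢ (Set.univ : Set ℝ)) :=
  isOpen_Ioo.prod isOpen_univ

theorem hasDerivAt_slice_fst {u : ℝ × ℝ → ℂ}
    (hu : ContDiffOn ℝ (⊤ : ℕ∞) u (Set.Ioo 0 Real.pi ×ˢ Set.univ)) {θ : ℝ}
    (hθ : θ ∈ Set.Ioo 0 Real.pi) (φ : ℝ) :
    HasDerivAt (fun t => u (t, φ)) (fderiv ℝ u (θ, φ) (1, 0)) θ := by
  have h := ((hu.contDiffAt (isOpen_strip.mem_nhds (x := (θ, φ)) ⟨hθ, trivial⟩)).differentiableAt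
    (by simp)).hasFDerivAt
  exact h.comp_hasDerivAt θ ((hasDerivAt_id θ).prodMk (hasDerivAt_const θ φ))

theorem hasDerivAt_slice_snd {u : ℝ × ℝ → ℂ}
    (hu : ContDiffOn ℝ (⊤ : ℕ∞) u (Set.Ioo 0 Real.pi ×ˢ Set.univ)) {θ : ℝ}
    (hθ : θ ∈ Set.Ioo 0 Real.pi) (φ : ℝ) :
    HasDerivAt (fun t => u (θ, t)) (fderiv ℝ u (θ, φ) (0, 1)) φ := by
  have h := ((hu.contDiffAt (isOpen_strip.mem_nhds (x := (θ, φ)) ⟨hθ, trivial⟩)).differentiableAt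
    (by simp)).hasFDerivAt
  exact h.comp_hasDerivAt φ ((hasDerivAt_const φ θ).prodMk (hasDerivAt_id φ))

theorem contDiffOn_pdθ {u : ℝ × ℝ → ℂ}
    (hu : ContDiffOn ℝ (⊤ : ℕ∞) u (Set.Ioo 0 Real.pi ×ˢ Set.univ)) :
    ContDiffOn ℝ (⊤ : ℕ∞) (pdθ u) (Set.Ioo 0 Real.pi ×ˢ Set.univ) :=
  ((hu.fderiv_of_isOpen isOpen_strip (by simp)).clm_apply contDiffOn_const).congr
    fun x hx => (hasDerivAt_slice_fst hu hx.1 x.2).deriv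

theorem contDiffOn_pdφ {u : ℝ × ℝ → ℂ}
    (hu : ContDiffOn ℝ (⊤ : ℕ∞) u (Set.Ioo 0 Real.pi ×ˢ Set.univ)) :
    ContDiffOn ℝ (⊤ : ℕ∞) (pdφ u) (Set.Ioo 0 Real.pi ×ˢ Set.univ) :=
  ((hu.fderiv_of_isOpen isOpen_strip (by simp)).clm_apply contDiffOn_const).congr
    fun x hx => (hasDerivAt_slice_snd hu hx.1 x.2).deriv

theorem continuous_slice {u : ℝ × ℝ → ℂ}
    (hu : ContDiffOn ℝ (⊤ : ℕ∞) u (Set.Ioo 0 Real.pi ×ˢ Set.univ)) {θ : ℝ}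
    (hθ : θ ∈ Set.Ioo 0 Real.pi) : Continuous fun φ => u (θ, φ) := by
  rw [continuous_iff_continuousAt]
  exact fun φ => (hasDerivAt_slice_snd hu hθ φ).continuousAt

theorem norm_exp_mode (m : ℤ) (φ : ℝ) : ‖Complex.exp (-(Complex.I * m * φ))‖ = 1 := by
  rw [show -(Complex.I * m * φ) = ((-(m * φ) : ℝ) : ℂ) * Complex.I by push_cast; ring,
    Complex.norm_exp_ofReal_mul_I]

theorem hasDerivAt_mode {u : ℝ × ℝ → ℂ}
    (hu : ContDiffOn ℝ (⊤ : ℕ∞) u (Set.Ioo 0 Real.pi ×ˢ Set.univ)) (m : ℤ) {θ : ℝ}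
    (hθ : θ ∈ Set.Ioo 0 Real.pi) : HasDerivAt (mode m u) (mode m (pdθ u) θ) θ := by
  obtain ⟨δ, hδ, hball⟩ := Metric.isOpen_iff.1 (isOpen_Ioo (a := (0 : ℝ)) (b := Real.pi)) θ hθ
  have hsub : Metric.closedBall θ (δ / 2) ⊆ Set.Ioo 0 Real.pi :=
    (Metric.closedBall_subset_ball (by linarith)).trans hball
  have hE : Continuous fun φ : ℝ => Complex.exp (-(Complex.I * m * φ)) := by fun_prop
  obtain ⟨M, hM⟩ := ((isCompact_closedBall θ (δ / 2)).prod
    (isCompact_Icc (a := -Real.pi) (b := Real.pi))).exists_bound_of_continuousOn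
    ((contDiffOn_pdθ hu).continuousOn.mono fun x hx => ⟨hsub hx.1, trivial⟩)
  refine (intervalIntegral.hasDerivAt_integral_of_dominated_loc_of_deriv_le
    (F := fun t φ => u (t, φ) * Complex.exp (-(Complex.I * m * φ)))
    (F' := fun t φ => pdθ u (t, φ) * Complex.exp (-(Complex.I * m * φ)))
    (bound := fun _ => M) (Metric.closedBall_mem_nhds θ (half_pos hδ)) ?_ ?_ ?_ ?_ ?_ ?_).2
  · filter_upwards [Ioo_mem_nhds hθ.1 hθ.2] with t ht
    exact ((continuous_slice hu ht).mul hE).aestronglyMeasurable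
  · exact ((continuous_slice hu hθ).mul hE).intervalIntegrable _ _
  · exact ((continuous_slice (contDiffOn_pdθ hu) hθ).mul hE).aestronglyMeasurable
  · refine Filter.Eventually.of_forall fun φ hφ t ht => ?_
    rw [norm_mul, norm_exp_mode, mul_one]
    rw [Set.uIoc_of_le (by linarith [Real.pi_pos])] at hφ
    exact hM (t, φ) ⟨ht, hφ.1.le, hφ.2⟩
  · exact intervalIntegrable_const
  · refine Filter.Eventually.of_forall fun φ _ t ht => ?_
    exact ((hasDerivAt_slice_fst hu (hsub ht) φ).differentiableAt.hasDerivAt).mul_const _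

theorem mode_pdφ {s : ℤ} {u : ℝ × ℝ → ℂ} (hu : North s u) (m : ℤ) {θ : ℝ}
    (hθ : θ ∈ Set.Ioo 0 Real.pi) : mode m (pdφ u) θ = Complex.I * m * mode m u θ := by
  have hc := hu.contDiffOn
  have hE : ∀ φ : ℝ, HasDerivAt (fun φ : ℝ => Complex.exp (-(Complex.I * m * φ)))
      (Complex.exp (-(Complex.I * m * φ)) * -(Complex.I * m)) φ := fun φ => by
    have := ((Complex.ofRealCLM.hasDerivAt (x := φ)).const_mul (Complex.I * (m : ℂ))).neg.cexp
    simpa using this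
  have hEc : Continuous fun φ : ℝ => Complex.exp (-(Complex.I * m * φ)) := by fun_prop
  have h := intervalIntegral.integral_mul_deriv_eq_deriv_mul (a := -Real.pi) (b := Real.pi)
    (fun φ _ => (hasDerivAt_slice_snd hc hθ φ).differentiableAt.hasDerivAt) (fun φ _ => hE φ)
    ((continuous_slice (contDiffOn_pdφ hc) hθ).intervalIntegrable _ _)
    ((hEc.mul continuous_const).intervalIntegrable _ _)
  have hper := hu.periodic hθ (-Real.pi)
  have hperE : Complex.exp (-(Complex.I * m * ((-Real.pi : ℝ) : ℂ))) =
      Complex.exp (-(Complex.I * m * (Real.pi : ℝ))) := by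
    rw [Complex.exp_eq_exp_iff_exists_int]
    exact ⟨m, by push_cast; ring⟩
  rw [show -Real.pi + 2 * Real.pi = Real.pi by ring] at hper
  simp only at hper
  rw [hper, hperE, sub_self, zero_sub] at h
  rw [mode, mode, ← intervalIntegral.integral_const_mul, eq_comm, ← sub_eq_zero, ← neg_eq_zero]
  have e1 : ∀ φ : ℝ, u (θ, φ) * (Complex.exp (-(Complex.I * m * φ)) * -(Complex.I * m)) =
    -(Complex.I * m * (u (θ, φ) * Complex.exp (-(Complex.I * m * φ)))) := fun φ => by ring
  simp only [e1, intervalIntegral.integral_neg] at h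
  rw [neg_inj] at h
  rw [h]
  simp only [pdφ, sub_self, neg_zero]

theorem Spin.bddCont_mode {s : ℤ} {u : ℝ × ℝ → ℂ} (hu : Spin s u) (m : ℤ) :
    BddCont (mode m u) := by
  obtain ⟨M, hM⟩ := hu.bounded
  refine ⟨fun θ hθ => (hasDerivAt_mode hu.1.contDiffOn m hθ).continuousAt.continuousWithinAt,
    M * |Real.pi - -Real.pi|, fun θ hθ => ?_⟩
  refine intervalIntegral.norm_integral_le_of_norm_le_const fun φ _ => ?_
  rw [norm_mul, norm_exp_mode, mul_one]
  exact hM θ hθ φ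

theorem mode_edth {s : ℤ} {u : ℝ × ℝ → ℂ} (hu : North s u) (ε m : ℤ) {θ : ℝ}
    (hθ : θ ∈ Set.Ioo 0 Real.pi) :
    Real.sin θ * mode m (pdθ u) θ = ε * (m + s * Real.cos θ) * mode m u θ -
      Real.sin θ * mode m (edth ε s u) θ := by
  have hc := hu.contDiffOn
  have hE : Continuous fun φ : ℝ => Complex.exp (-(Complex.I * m * φ)) := by fun_prop
  have hint : ∀ {v : ℝ × ℝ → ℂ}, ContDiffOn ℝ (⊤ : ℕ∞) v (Set.Ioo 0 Real.pi ×ˢ Set.univ) →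
      IntervalIntegrable (fun φ : ℝ => v (θ, φ) * Complex.exp (-(Complex.I * m * φ)))
        MeasureTheory.volume (-Real.pi) Real.pi := fun hv =>
    ((continuous_slice hv hθ).mul hE).intervalIntegrable _ _
  have h1 := hint (contDiffOn_pdθ hc)
  have h2 := hint (contDiffOn_pdφ hc)
  have h3 := hint hc
  have hs : (Real.sin θ : ℂ) ≠ 0 := by
    exact_mod_cast (Real.sin_pos_of_pos_of_lt_pi hθ.1 hθ.2).ne'
  have e : mode m (edth ε s u) θ = -(mode m (pdθ u) θ +
      ε * Complex.I / Real.sin θ * mode m (pdφ u) θ -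
      ε * s * (Real.cos θ / Real.sin θ) * mode m u θ) := by
    rw [mode, mode, mode, mode, ← intervalIntegral.integral_const_mul,
      ← intervalIntegral.integral_const_mul, ← intervalIntegral.integral_add h1 (h2.const_mul _),
      ← intervalIntegral.integral_sub (h1.add (h2.const_mul _)) (h3.const_mul _),
      ← intervalIntegral.integral_neg]
    congr 1
    funext φ
    simp only [edth]
    ring
  rw [e, mode_pdφ hu m hθ]
  field_simp
  linear_combination (-(ε * m * mode m u θ)) * Complex.I_sq

theorem pair_mode_laplacian {s : ℤ} {u : ℝ × ℝ → ℂ} (hu : Spin s u) (m : ℤ) {l : ℤ}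
    (hl : |s| ≤ l) :
    ((l - s) * (l + s + 1) : ℂ) * pair (mode m u) l s m =
      -pair (mode m (edth (-1) (s + 1) (edth 1 s u))) l s m := by
  have hu1 : Spin (s + 1) (edth 1 s u) := hu.edth (by norm_num)
  have hu2 : Spin (s + 1 + -1) (edth (-1) (s + 1) (edth 1 s u)) := hu1.edth (by norm_num)
  have r := pair_raise (s := s) (m := m) (hu.bddCont_mode m) (hu1.bddCont_mode m)
    (fun θ hθ => hasDerivAt_mode hu.1.contDiffOn m hθ) (fun θ hθ => by
      rw [mode_edth hu.1 1 m hθ, Int.cast_one, one_mul]) l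
  have r' := pair_lower (s := s + 1) (m := m) (hu1.bddCont_mode m) (hu2.bddCont_mode m)
    (fun θ hθ => hasDerivAt_mode hu1.1.contDiffOn m hθ) (fun θ hθ => by
      rw [mode_edth hu1.1 (-1) m hθ, Int.cast_neg, Int.cast_one, neg_one_mul]) l
  rw [add_sub_cancel_right] at r'
  rw [r', r]
  have h := ladder_sq (l := l) (s := s + 1) (by linarith [(abs_le.1 hl).1])
    (by linarith [(abs_le.1 hl).2])
  have h' : (ladder l (s + 1) : ℂ) ^ 2 = (l - s) * (l + s + 1) := by
    rw [← Complex.ofReal_pow, h]; push_cast; ring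
  linear_combination (-pair (mode m u) l s m) * h'

theorem Spin.norm_pair_le {s : ℤ} {u : ℝ × ℝ → ℂ} (hu : Spin s u) :
    ∃ C : ℝ, 0 ≤ C ∧ ∀ l m : ℤ, 0 ≤ l → ‖pair (mode m u) l s m‖ ≤ C * (l + 1) := by
  obtain ⟨M, hM⟩ := hu.bounded
  have hM0 : 0 ≤ M := (norm_nonneg _).trans
    (hM (Real.pi / 2) ⟨by linarith [Real.pi_pos], by linarith [Real.pi_pos]⟩ 0)
  have hpi := Real.pi_pos
  refine ⟨M * |Real.pi - -Real.pi| * |Real.pi - 0|, by positivity, fun l m hl => ?_⟩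
  have hl' : (0 : ℝ) ≤ l := by exact_mod_cast hl
  have hcont : BddCont (mode m u) := hu.bddCont_mode m
  have hb : ∀ θ ∈ Set.Ioo 0 Real.pi, ‖mode m u θ‖ ≤ M * |Real.pi - -Real.pi| := fun θ hθ => by
    refine intervalIntegral.norm_integral_le_of_norm_le_const fun φ _ => ?_
    rw [norm_mul, norm_exp_mode, mul_one]
    exact hM θ hθ φ
  have : ‖pair (mode m u) l s m‖ ≤ (M * |Real.pi - -Real.pi| * (l + 1)) * |Real.pi - 0| := by
    refine intervalIntegral.norm_integral_le_of_norm_le_const fun θ hθ => ?_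
    rw [Set.uIoc_of_le hpi.le] at hθ
    rcases hθ.2.eq_or_lt with h | h
    · rw [h, Real.sin_pi, Complex.ofReal_zero, mul_zero, norm_zero]
      positivity
    · rw [norm_mul, norm_mul, Complex.norm_real, Complex.norm_real, Real.norm_eq_abs,
        Real.norm_eq_abs]
      calc _ ≤ (M * |Real.pi - -Real.pi|) * (l + 1) * 1 :=
            mul_le_mul (mul_le_mul (hb θ ⟨hθ.1, h⟩) (abs_polarY_le hl s m θ) (abs_nonneg _)
              (by positivity)) (Real.abs_sin_le_one θ) (abs_nonneg _) (by positivity)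
        _ = _ := mul_one _
  linarith

theorem add_one_le_laplacian {l s : ℤ} (h : |s| < l) :
    ((l : ℝ) + 1) ≤ (l - s) * (l + s + 1) := by
  have h1 := abs_lt.1 h
  have : l + 1 ≤ (l - s) * (l + s + 1) := by
    rcases le_total 0 s with h | h <;> nlinarith
  exact_mod_cast this

theorem Spin.norm_pair_mul_pow_le (k : ℕ) : ∀ {s : ℤ} {u : ℝ × ℝ → ℂ}, Spin s u →
    ∃ C : ℝ, 0 ≤ C ∧ ∀ l m : ℤ, |s| < l →
      ‖pair (mode m u) l s m‖ * ((l : ℝ) + 1) ^ k ≤ C * (l + 1) := by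
  induction k with
  | zero =>
    intro s u hu
    obtain ⟨C, hC, h⟩ := hu.norm_pair_le
    exact ⟨C, hC, fun l m hl => by
      rw [pow_zero, mul_one]; exact h l m ((abs_nonneg s).trans hl.le)⟩
  | succ k ih =>
    intro s u hu
    have hu2 : Spin (s + 1 + -1) (_root_.edth (-1) (s + 1) (_root_.edth 1 s u)) :=
      (hu.edth (by norm_num)).edth (by norm_num)
    rw [add_neg_cancel_right] at hu2
    obtain ⟨C, hC, h⟩ := ih hu2
    refine ⟨C, hC, fun l m hl => ?_⟩
    have hl0 : (0 : ℝ) ≤ l := by exact_mod_cast (abs_nonneg s).trans hl.le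
    have e := congrArg norm (pair_mode_laplacian hu m hl.le)
    have hpos := add_one_le_laplacian hl
    rw [norm_neg, norm_mul, show ((l - s) * (l + s + 1) : ℂ) =
      (((l - s) * (l + s + 1) : ℝ) : ℂ) by push_cast; ring, Complex.norm_real, Real.norm_eq_abs,
      abs_of_nonneg (by linarith)] at e
    refine le_trans ?_ (h l m hl)
    rw [← e, pow_succ']
    have : 0 ≤ ‖pair (mode m u) l s m‖ * ((l : ℝ) + 1) ^ k := by positivity
    nlinarith

theorem Spin.decay {s : ℤ} {u : ℝ × ℝ → ℂ} (hu : Spin s u) (N : ℕ) :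
    ∃ C : ℝ, 0 ≤ C ∧ ∀ l m : ℤ, |s| ≤ l →
      ‖pair (mode m u) l s m‖ ≤ C * ((l : ℝ) + 1) ^ (-(N : ℤ)) := by
  obtain ⟨C, hC, h⟩ := hu.norm_pair_mul_pow_le (N + 1)
  obtain ⟨C', hC', h'⟩ := hu.norm_pair_le
  refine ⟨max C (C' * ((|s| : ℤ) + 1) * ((|s| : ℤ) + 1) ^ N), le_max_of_le_left hC,
    fun l m hl => ?_⟩
  have hl0 : (0 : ℝ) ≤ l := by exact_mod_cast (abs_nonneg s).trans hl
  rw [zpow_neg, zpow_natCast, ← div_eq_mul_inv, le_div_iff₀ (by positivity)]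
  rcases hl.eq_or_lt with rfl | hlt
  · refine le_max_of_le_right ?_
    exact mul_le_mul_of_nonneg_right (h' _ m (abs_nonneg s)) (by positivity)
  · refine le_max_of_le_left ?_
    have := h l m hlt
    rw [pow_succ, ← mul_assoc] at this
    exact le_of_mul_le_mul_right this (by positivity)

theorem dot3_mulVec_transpose {R : Matrix (Fin 3) (Fin 3) ℝ} (hR : R ∈ SO3set) (p : Fin 3 → ℝ) :
    dot3 (Matrix.mulVec R.transpose p) (Matrix.mulVec R.transpose p) = dot3 p p := by
  have h : ∀ v w : Fin 3 → ℝ, dot3 v w = v ⬝ᵥ w := fun v w => by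
    simp [dot3, dotProduct, Fin.sum_univ_three]
  rw [h, h, Matrix.dotProduct_mulVec, ← Matrix.mulVec_transpose, Matrix.transpose_transpose,
    Matrix.mulVec_mulVec, hR.1, Matrix.one_mulVec]

theorem one_mem_SO3set : (1 : Matrix (Fin 3) (Fin 3) ℝ) ∈ SO3set := by
  simp [SO3set]

theorem mem_UI_iff {p : Fin 3 → ℝ} (hp : dot3 p p = 1) : p ∈ UI ↔ 0 < p 0 ^ 2 + p 1 ^ 2 := by
  have h : p 0 ^ 2 + p 1 ^ 2 = (1 - p 2) * (1 + p 2) := by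
    simp only [dot3] at hp; linear_combination hp
  constructor
  · rintro ⟨-, hN, hS⟩
    refine lt_of_le_of_ne (by positivity) fun h0 => ?_
    have e0 : p 0 = 0 := by nlinarith [sq_nonneg (p 0), sq_nonneg (p 1)]
    have e1 : p 1 = 0 := by nlinarith [sq_nonneg (p 0), sq_nonneg (p 1)]
    rw [h] at h0
    rcases mul_eq_zero.1 h0.symm with h2 | h2
    · apply hN; ext i; fin_cases i
      · simpa [NP] using e0
      · simpa [NP] using e1
      · simp [NP]; linarith
    · apply hS; ext i; fin_cases i
      · simpa [SP] using e0
      · simpa [SP] using e1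
      · simp [SP]; linarith
  · intro hpos
    refine ⟨hp, ?_, ?_⟩ <;> rintro rfl <;> simp [NP, SP] at hpos

theorem contDiffAt_zpow_comp {E : Type*} [NormedAddCommGroup E] [NormedSpace ℝ E] {h : E → ℂ}
    {x : E} (hh : ContDiffAt ℝ (⊤ : ℕ∞) h x) (h0 : h x ≠ 0) (s : ℤ) :
    ContDiffAt ℝ (⊤ : ℕ∞) (fun y => h y ^ s) x := by
  cases s with
  | ofNat n => simpa using hh.pow n
  | negSucc n =>
    simp only [zpow_negSucc]
    exact (hh.pow (n + 1)).inv (pow_ne_zero _ h0)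


theorem sphCoords_arccos_arg {q : Fin 3 → ℝ} (hq : dot3 q q = 1) {c : ℂ} (hc : c ≠ 0) :
    sphCoords (Real.arccos (q 2))
      ((((q 0 : ℂ) + q 1 * Complex.I) * (starRingEnd ℂ) c).arg + c.arg) = q := by
  set w : ℂ := (q 0 : ℂ) + q 1 * Complex.I with hwdef
  have hwre : w.re = q 0 := by simp [hwdef]
  have hwim : w.im = q 1 := by simp [hwdef]
  have hn : ‖w‖ = Real.sqrt (1 - q 2 ^ 2) := by
    rw [Complex.norm_eq_sqrt_sq_add_sq, hwre, hwim]
    congr 1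
    simp only [dot3] at hq; linear_combination hq
  have hq2 : -1 ≤ q 2 ∧ q 2 ≤ 1 := by
    rw [← abs_le, ← sq_le_one_iff_abs_le_one]
    simp only [dot3] at hq
    nlinarith [sq_nonneg (q 0), sq_nonneg (q 1)]
  set Φ := (w * (starRingEnd ℂ) c).arg + c.arg with hΦ
  have hexp : (‖w‖ : ℂ) * Complex.exp (Φ * Complex.I) = w := by
    have h1 := Complex.norm_mul_exp_arg_mul_I (w * (starRingEnd ℂ) c)
    have h2 := Complex.norm_mul_exp_arg_mul_I c
    have hcn : (‖c‖ : ℂ) ≠ 0 := by exact_mod_cast (norm_ne_zero_iff.2 hc)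
    have hcc : (starRingEnd ℂ) c * c = (‖c‖ : ℂ) ^ 2 := by
      rw [mul_comm, Complex.mul_conj, Complex.normSq_eq_norm_sq]; push_cast; rfl
    rw [norm_mul, RCLike.norm_conj] at h1
    rw [hΦ, Complex.ofReal_add, add_mul, Complex.exp_add]
    have h3 := congrArg₂ (· * ·) h1 h2
    rw [mul_assoc w, hcc] at h3
    push_cast at h3
    have : (‖c‖ : ℂ) ^ 2 ≠ 0 := pow_ne_zero _ hcn
    apply mul_right_cancel₀ this
    linear_combination h3
  have hre := congrArg Complex.re hexp
  have him := congrArg Complex.im hexp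
  rw [Complex.re_ofReal_mul, Complex.exp_ofReal_mul_I_re, hwre] at hre
  rw [Complex.im_ofReal_mul, Complex.exp_ofReal_mul_I_im, hwim] at him
  ext i
  fin_cases i
  · simpa [sphCoords, Real.sin_arccos, ← hn] using hre
  · simpa [sphCoords, Real.sin_arccos, ← hn] using him
  · simpa [sphCoords] using Real.cos_arccos hq2.1 hq2.2

theorem contDiffAt_spin_comp {R : Matrix (Fin 3) (Fin 3) ℝ} (hR : R ∈ SO3set)
    {h : (Fin 3 → ℝ) → ℂ}
    (hsmooth : ContDiffOn ℝ (⊤ : ℕ∞) (fun x : ℝ × ℝ => h (Matrix.mulVec R (sphCoords x.1 x.2)))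
      (Set.Ioo 0 Real.pi ×ˢ Set.univ))
    {E : Type*} [NormedAddCommGroup E] [NormedSpace ℝ E] {P : E → Fin 3 → ℝ}
    (hP : ContDiff ℝ (⊤ : ℕ∞) P) (hP1 : ∀ e, dot3 (P e) (P e) = 1) {e₀ : E}
    (he₀ : P e₀ ∈ chartU R) : ContDiffAt ℝ (⊤ : ℕ∞) (fun e => h (P e)) e₀ := by
  set Q : E → Fin 3 → ℝ := fun e => Matrix.mulVec R.transpose (P e) with hQ
  have hQc : ∀ i, ContDiff ℝ (⊤ : ℕ∞) fun e => Q e i := fun i => by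
    simp only [hQ, Matrix.mulVec, dotProduct]
    exact ContDiff.sum fun j _ => contDiff_const.mul ((contDiff_pi.1 hP) j)
  have hQ1 : ∀ e, dot3 (Q e) (Q e) = 1 := fun e => by
    simp only [hQ]; rw [dot3_mulVec_transpose hR, hP1]
  have hRQ : ∀ e, Matrix.mulVec R (Q e) = P e := fun e => by
    simp only [hQ]; rw [Matrix.mulVec_mulVec, hR.1, Matrix.one_mulVec]
  have hpos : 0 < Q e₀ 0 ^ 2 + Q e₀ 1 ^ 2 := (mem_UI_iff (hQ1 e₀)).1 he₀
  set w : E → ℂ := fun e => (Q e 0 : ℂ) + Q e 1 * Complex.I with hw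
  have hwc : ContDiff ℝ (⊤ : ℕ∞) w :=
    (Complex.ofRealCLM.contDiff.comp (hQc 0)).add
      ((Complex.ofRealCLM.contDiff.comp (hQc 1)).mul contDiff_const)
  have hw0 : w e₀ ≠ 0 := fun h0 => by
    have h1 := congrArg Complex.re h0
    have h2 := congrArg Complex.im h0
    simp [hw] at h1 h2
    rw [h1, h2] at hpos; simp at hpos
  have hq2 : Q e₀ 2 ^ 2 < 1 := by
    have := hQ1 e₀; simp only [dot3] at this; nlinarith
  have hq2' := abs_lt.1 ((sq_lt_one_iff_abs_lt_one _).1 hq2)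
  set Θ : E → ℝ := fun e => Real.arccos (Q e 2)
  set Φ : E → ℝ := fun e => (w e * (starRingEnd ℂ) (w e₀)).arg + (w e₀).arg
  have hΘ : ContDiffAt ℝ (⊤ : ℕ∞) Θ e₀ :=
    ContDiffAt.comp (g := Real.arccos) e₀ (Real.contDiffAt_arccos hq2'.1.ne' hq2'.2.ne)
      (hQc 2).contDiffAt
  have hslit : w e₀ * (starRingEnd ℂ) (w e₀) ∈ Complex.slitPlane := by
    rw [Complex.mul_conj, Complex.ofReal_mem_slitPlane]
    exact Complex.normSq_pos.2 hw0
  have hΦ : ContDiffAt ℝ (⊤ : ℕ∞) Φ e₀ := by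
    refine ContDiffAt.add ?_ contDiffAt_const
    have h1 : ContDiffAt ℝ (⊤ : ℕ∞) (fun e => Complex.log (w e * (starRingEnd ℂ) (w e₀))) e₀ :=
      ContDiffAt.comp (g := Complex.log) e₀ ((Complex.contDiffAt_log hslit).restrict_scalars ℝ)
        (hwc.mul contDiff_const).contDiffAt
    have h2 := Complex.imCLM.contDiff.contDiffAt.comp e₀ h1
    simpa only [Function.comp_def, Complex.imCLM_apply, Complex.log_im] using h2
  have hΘmem : Θ e₀ ∈ Set.Ioo 0 Real.pi :=
    ⟨Real.arccos_pos.2 hq2'.2, lt_of_le_of_ne (Real.arccos_le_pi _) fun h => by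
      have := Real.arccos_eq_pi.1 h; linarith [hq2'.1]⟩
  have hev : ∀ e, P e = Matrix.mulVec R (sphCoords (Θ e) (Φ e)) := fun e => by
    rw [sphCoords_arccos_arg (hQ1 e) hw0, hRQ]
  clear_value Θ Φ
  simp only [hev]
  exact (hsmooth.contDiffAt (isOpen_strip.mem_nhds (x := (Θ e₀, Φ e₀)) ⟨hΘmem, trivial⟩)).comp e₀
    (f := fun e => (Θ e, Φ e)) (hΘ.prodMk hΦ)

theorem exp_arg_zpow {z : ℂ} (hz : ‖z‖ = 1) (s : ℤ) :
    Complex.exp (Complex.I * s * z.arg) = z ^ s := by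
  have h := Complex.norm_mul_exp_arg_mul_I z
  rw [hz, Complex.ofReal_one, one_mul] at h
  conv_rhs => rw [← h]
  rw [← Complex.exp_int_mul]
  congr 1; ring

theorem IsSpinFamily.eq_zpow {s : ℤ} {f : Matrix (Fin 3) (Fin 3) ℝ → (Fin 3 → ℝ) → ℂ}
    (hspin : IsSpinFamily s f) {R₁ R₂ : Matrix (Fin 3) (Fin 3) ℝ} (h₁ : R₁ ∈ SO3set)
    (h₂ : R₂ ∈ SO3set) {p : Fin 3 → ℝ} (hp : p ∈ chartU R₁ ∩ chartU R₂) {z : ℂ} (hz : ‖z‖ = 1)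
    (h : rhoR R₂ p = z.re • rhoR R₁ p + z.im • (crossProduct (rhoR R₁ p) p)) :
    f R₂ p = z ^ s * f R₁ p := by
  rw [← exp_arg_zpow hz]
  refine hspin R₁ h₁ R₂ h₂ p hp z.arg (Complex.arg_mem_Ioc z) ?_
  have h0 : z ≠ 0 := by rintro rfl; simp at hz
  rw [Complex.cos_arg h0, Complex.sin_arg, hz, div_one, div_one]
  exact h

/-- The rotation taking the polar axis to the first coordinate axis. -/
def axisRot : Matrix (Fin 3) (Fin 3) ℝ := !![0, 0, 1; 1, 0, 0; 0, 1, 0]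

theorem axisRot_mem : axisRot ∈ SO3set := by
  refine ⟨?_, ?_⟩
  · ext i j; fin_cases i <;> fin_cases j <;> simp [axisRot, Matrix.mul_apply, Fin.sum_univ_three]
  · simp [axisRot, Matrix.det_fin_three]

theorem axisRot_transpose_mulVec (p : Fin 3 → ℝ) :
    Matrix.mulVec axisRot.transpose p = ![p 1, p 2, p 0] := by
  ext i; fin_cases i <;> simp [axisRot, Matrix.mulVec, dotProduct, Fin.sum_univ_three]

theorem mem_chartU_axisRot {p : Fin 3 → ℝ} (hp : dot3 p p = 1) :
    p ∈ chartU axisRot ↔ 0 < p 1 ^ 2 + p 2 ^ 2 := by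
  have h : dot3 ![p 1, p 2, p 0] ![p 1, p 2, p 0] = 1 := by
    rw [← hp]; simp [dot3]; ring
  simp only [chartU, Set.mem_ofPred_eq, axisRot_transpose_mulVec, mem_UI_iff h]
  simp

theorem mem_chartU_one {p : Fin 3 → ℝ} (hp : dot3 p p = 1) :
    p ∈ chartU 1 ↔ 0 < p 0 ^ 2 + p 1 ^ 2 := by
  rw [← mem_UI_iff hp]
  simp [chartU]

theorem rhoR_axisRot (p : Fin 3 → ℝ) :
    rhoR axisRot p = (Real.sqrt (p 1 ^ 2 + p 2 ^ 2))⁻¹ • ![0, -p 2, p 1] := by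
  rw [rhoR, axisRot_transpose_mulVec]
  ext i
  fin_cases i <;> simp [rhoI, axisRot, Matrix.mulVec, dotProduct, Fin.sum_univ_three]

theorem rhoR_one_eq {p : Fin 3 → ℝ} (h1 : 0 < p 0 ^ 2 + p 1 ^ 2)
    (h2 : 0 < p 1 ^ 2 + p 2 ^ 2) :
    rhoR 1 p = (-(p 0 * p 2) / (Real.sqrt (p 0 ^ 2 + p 1 ^ 2) * Real.sqrt (p 1 ^ 2 + p 2 ^ 2))) •
        rhoR axisRot p +
      (p 1 / (Real.sqrt (p 0 ^ 2 + p 1 ^ 2) * Real.sqrt (p 1 ^ 2 + p 2 ^ 2))) •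
        crossProduct (rhoR axisRot p) p := by
  have a1 := Real.sqrt_pos.2 h1
  have a2 := Real.sqrt_pos.2 h2
  have b2 := Real.sq_sqrt h2.le
  rw [rhoR_axisRot]
  set ρ := Real.sqrt (p 0 ^ 2 + p 1 ^ 2) with hρ
  set r := Real.sqrt (p 1 ^ 2 + p 2 ^ 2)
  ext i
  fin_cases i <;> simp [rhoR, rhoI, crossProduct, ← hρ] <;> field_simp
  · rw [b2]; ring
  · rw [b2]; ring
  · ring

/-- Inverse stereographic projection from the south pole. -/
def stereo (z : ℂ) : Fin 3 → ℝ :=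
  ![2 * z.re / (1 + ‖z‖ ^ 2), 2 * z.im / (1 + ‖z‖ ^ 2), (1 - ‖z‖ ^ 2) / (1 + ‖z‖ ^ 2)]

theorem norm_sq_eq (z : ℂ) : ‖z‖ ^ 2 = z.re ^ 2 + z.im ^ 2 := by
  rw [Complex.sq_norm, Complex.normSq_apply]; ring

theorem dot3_stereo (z : ℂ) : dot3 (stereo z) (stereo z) = 1 := by
  have : (1 + (z.re ^ 2 + z.im ^ 2)) ≠ 0 := by positivity
  simp only [stereo, dot3, norm_sq_eq, Matrix.cons_val]
  field_simp
  ring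

theorem contDiff_norm_sq_complex : ContDiff ℝ (⊤ : ℕ∞) fun z : ℂ => ‖z‖ ^ 2 :=
  contDiff_norm_sq ℝ

theorem contDiff_stereo : ContDiff ℝ (⊤ : ℕ∞) stereo := by
  have h0 : ∀ z : ℂ, 1 + ‖z‖ ^ 2 ≠ 0 := fun z => by positivity
  have h1 : ContDiff ℝ (⊤ : ℕ∞) fun z : ℂ => 1 + ‖z‖ ^ 2 :=
    contDiff_const.add contDiff_norm_sq_complex
  rw [contDiff_pi]
  intro i
  fin_cases i
  · exact (contDiff_const.mul Complex.reCLM.contDiff).div h1 h0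
  · exact (contDiff_const.mul Complex.imCLM.contDiff).div h1 h0
  · exact (contDiff_const.sub contDiff_norm_sq_complex).div h1 h0

theorem stereo_tan_half {θ : ℝ} (hθ : θ ∈ Set.Ioo 0 Real.pi) (φ : ℝ) :
    stereo ((Real.tan (θ / 2) : ℂ) * Complex.exp (Complex.I * φ)) = sphCoords θ φ := by
  obtain ⟨ht, hs, hc⟩ := sin_cos_tan_half hθ
  have hn : ‖(Real.tan (θ / 2) : ℂ) * Complex.exp (Complex.I * φ)‖ ^ 2 = Real.tan (θ / 2) ^ 2 := by
    rw [norm_mul, mul_comm Complex.I, Complex.norm_exp_ofReal_mul_I, mul_one, Complex.norm_real,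
      Real.norm_eq_abs, sq_abs]
  rw [stereo, sphCoords, hn, Complex.re_ofReal_mul, Complex.im_ofReal_mul, mul_comm Complex.I,
    Complex.exp_ofReal_mul_I_re, Complex.exp_ofReal_mul_I_im, hs, hc]
  ext i
  fin_cases i <;> simp <;> ring

theorem stereo_axis_pos {z : ℂ} (hz : ‖z‖ < 1) : 0 < stereo z 1 ^ 2 + stereo z 2 ^ 2 := by
  have h : 0 < stereo z 2 := by
    simp only [stereo, Matrix.cons_val]
    have : ‖z‖ ^ 2 < 1 := by nlinarith [norm_nonneg z]
    exact div_pos (by linarith) (by positivity)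
  positivity

theorem stereo_pole_pos {z : ℂ} (hz : z ≠ 0) : 0 < stereo z 0 ^ 2 + stereo z 1 ^ 2 := by
  have h : 0 < ‖z‖ ^ 2 := by positivity
  have : stereo z 0 ^ 2 + stereo z 1 ^ 2 = 4 * ‖z‖ ^ 2 / (1 + ‖z‖ ^ 2) ^ 2 := by
    simp only [stereo, Matrix.cons_val]
    rw [div_pow, div_pow, ← add_div, norm_sq_eq]; ring
  rw [this]; positivity

/-- The phase relating the standard frame, untwisted at the north pole, to the frame of
`axisRot`. -/
def framePhase (z : ℂ) : ℂ :=
  (-1 + ((2 * z.re / (1 + ‖z‖ ^ 2) : ℝ) : ℂ) * z) /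
    ((Real.sqrt (stereo z 1 ^ 2 + stereo z 2 ^ 2) : ℝ) : ℂ)

theorem contDiffAt_framePhase {z : ℂ} (hz : ‖z‖ < 1) : ContDiffAt ℝ (⊤ : ℕ∞) framePhase z := by
  have h0 : ∀ z : ℂ, 1 + ‖z‖ ^ 2 ≠ 0 := fun z => by positivity
  have h1 : ContDiff ℝ (⊤ : ℕ∞) fun z : ℂ => 1 + ‖z‖ ^ 2 :=
    contDiff_const.add contDiff_norm_sq_complex
  have h2 : ContDiff ℝ (⊤ : ℕ∞) fun z : ℂ => ((2 * z.re / (1 + ‖z‖ ^ 2) : ℝ) : ℂ) :=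
    Complex.ofRealCLM.contDiff.comp ((contDiff_const.mul Complex.reCLM.contDiff).div h1 h0)
  have h3 : ContDiffAt ℝ (⊤ : ℕ∞)
      (fun z : ℂ => ((Real.sqrt (stereo z 1 ^ 2 + stereo z 2 ^ 2) : ℝ) : ℂ)) z :=
    Complex.ofRealCLM.contDiff.contDiffAt.comp z
      (((((contDiff_pi.1 contDiff_stereo) 1).pow 2).add
        (((contDiff_pi.1 contDiff_stereo) 2).pow 2)).contDiffAt.sqrt (stereo_axis_pos hz).ne')
  refine (contDiff_const.add (h2.mul contDiff_id)).contDiffAt.mul (h3.inv ?_)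
  exact_mod_cast (Real.sqrt_pos.2 (stereo_axis_pos hz)).ne'

/-- The phase relating the standard frame to the frame of `axisRot`. -/
def poleAxisPhase (z : ℂ) : ℂ :=
  ⟨-(stereo z 0 * stereo z 2) / (Real.sqrt (stereo z 0 ^ 2 + stereo z 1 ^ 2) *
      Real.sqrt (stereo z 1 ^ 2 + stereo z 2 ^ 2)),
    stereo z 1 / (Real.sqrt (stereo z 0 ^ 2 + stereo z 1 ^ 2) *
      Real.sqrt (stereo z 1 ^ 2 + stereo z 2 ^ 2))⟩

theorem norm_poleAxisPhase {z : ℂ} (h0 : z ≠ 0) (h1 : ‖z‖ < 1) : ‖poleAxisPhase z‖ = 1 := by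
  have a := stereo_pole_pos h0
  have b := stereo_axis_pos h1
  have e := dot3_stereo z
  simp only [dot3] at e
  rw [← sq_eq_sq₀ (norm_nonneg _) zero_le_one, norm_sq_eq]
  simp only [poleAxisPhase]
  rw [div_pow, div_pow, mul_pow, Real.sq_sqrt a.le, Real.sq_sqrt b.le, ← add_div, one_pow,
    div_eq_one_iff_eq (mul_pos a b).ne']
  linear_combination (-stereo z 1 ^ 2) * e

theorem framePhase_eq {z : ℂ} (h0 : z ≠ 0) (h1 : ‖z‖ < 1) :
    framePhase z = z / ‖z‖ * poleAxisPhase z := by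
  have b := Real.sqrt_pos.2 (stereo_axis_pos h1)
  have hN : 0 < ‖z‖ := norm_pos_iff.2 h0
  have hρ : Real.sqrt (stereo z 0 ^ 2 + stereo z 1 ^ 2) = 2 * ‖z‖ / (1 + ‖z‖ ^ 2) := by
    rw [Real.sqrt_eq_iff_mul_self_eq (stereo_pole_pos h0).le (by positivity)]
    simp only [stereo, Matrix.cons_val]
    rw [div_pow, div_pow, ← add_div, ← pow_two, div_pow, mul_pow, mul_pow, mul_pow, ← mul_add,
      ← norm_sq_eq]
  have hn := norm_sq_eq z
  have hzd : z = (z.re : ℂ) + z.im * Complex.I := (Complex.re_add_im z).symm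
  have hp : poleAxisPhase z = ((-(stereo z 0 * stereo z 2) /
      (Real.sqrt (stereo z 0 ^ 2 + stereo z 1 ^ 2) *
        Real.sqrt (stereo z 1 ^ 2 + stereo z 2 ^ 2)) : ℝ) : ℂ) +
      ((stereo z 1 / (Real.sqrt (stereo z 0 ^ 2 + stereo z 1 ^ 2) *
        Real.sqrt (stereo z 1 ^ 2 + stereo z 2 ^ 2)) : ℝ) : ℂ) * Complex.I := by
    rw [poleAxisPhase, Complex.mk_eq_add_mul_I]
  rw [hp, framePhase, hρ]
  set r := Real.sqrt (stereo z 1 ^ 2 + stereo z 2 ^ 2)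
  simp only [stereo, Matrix.cons_val]
  set N := ‖z‖
  have hN' : (N : ℂ) ≠ 0 := by exact_mod_cast hN.ne'
  have hr' : (r : ℂ) ≠ 0 := by exact_mod_cast b.ne'
  have hM : (1 + (N : ℂ) ^ 2) ≠ 0 := by
    have : (1 + N ^ 2) ≠ 0 := by positivity
    exact_mod_cast this
  have hn' : (N : ℂ) ^ 2 = (z.re : ℂ) ^ 2 + (z.im : ℂ) ^ 2 := by exact_mod_cast hn
  have hbI : (z.im : ℂ) * Complex.I = z - z.re := by linear_combination -hzd
  have hz1 : (N : ℂ) ^ 2 = z * (2 * z.re - z) := by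
    linear_combination hn' - (z.im * Complex.I + z - z.re) * hbI + (z.im : ℂ) ^ 2 * Complex.I_sq
  push_cast
  field_simp
  linear_combination (-z * (1 + (N : ℂ) ^ 2)) * hbI - (1 + (N : ℂ) ^ 2) * hz1

theorem framePhase_zpow_mul {s : ℤ} {f : Matrix (Fin 3) (Fin 3) ℝ → (Fin 3 → ℝ) → ℂ}
    (hspin : IsSpinFamily s f) {z : ℂ} (h0 : z ≠ 0) (h1 : ‖z‖ < 1) :
    framePhase z ^ s * f axisRot (stereo z) = (z / ‖z‖) ^ s * f 1 (stereo z) := by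
  have hp := dot3_stereo z
  rw [hspin.eq_zpow axisRot_mem one_mem_SO3set
    ⟨(mem_chartU_axisRot hp).2 (stereo_axis_pos h1), (mem_chartU_one hp).2 (stereo_pole_pos h0)⟩
    (norm_poleAxisPhase h0 h1) (rhoR_one_eq (stereo_pole_pos h0) (stereo_axis_pos h1)),
    framePhase_eq h0 h1, mul_zpow, mul_assoc]

theorem contDiffAt_unit_phase {z : ℂ} (h0 : z ≠ 0) (s : ℤ) :
    ContDiffAt ℝ (⊤ : ℕ∞) (fun z : ℂ => (z / ‖z‖) ^ s) z := by
  have hn : ((‖z‖ : ℝ) : ℂ) ≠ 0 := by exact_mod_cast (norm_ne_zero_iff.2 h0)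
  refine contDiffAt_zpow_comp (h := fun z : ℂ => z / ‖z‖) ?_ (div_ne_zero h0 hn) s
  exact contDiffAt_id.mul ((Complex.ofRealCLM.contDiff.contDiffAt.comp z
    (contDiffAt_norm ℝ h0)).inv hn)

theorem north_of_spinFamily {s : ℤ} {f : Matrix (Fin 3) (Fin 3) ℝ → (Fin 3 → ℝ) → ℂ}
    (hsmooth : ∀ R ∈ SO3set, ContDiffOn ℝ (⊤ : ℕ∞)
      (fun x : ℝ × ℝ => f R (Matrix.mulVec R (sphCoords x.1 x.2)))
      (Set.Ioo 0 Real.pi ×ˢ Set.univ))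
    (hspin : IsSpinFamily s f) : North s fun x => f 1 (sphCoords x.1 x.2) := by
  have hev : ∀ z : ℂ, z ≠ 0 → (if ‖z‖ < 1 then framePhase z ^ s * f axisRot (stereo z)
      else (z / ‖z‖) ^ s * f 1 (stereo z)) = (z / ‖z‖) ^ s * f 1 (stereo z) := fun z hz => by
    split_ifs with h
    · exact framePhase_zpow_mul hspin hz h
    · rfl
  refine ⟨fun z => if ‖z‖ < 1 then framePhase z ^ s * f axisRot (stereo z)
    else (z / ‖z‖) ^ s * f 1 (stereo z), ?_, ?_⟩
  · rw [contDiff_iff_contDiffAt]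
    intro z
    by_cases hz : z = 0
    · have hz1 : ‖z‖ < 1 := by rw [hz, norm_zero]; exact one_pos
      have : ContDiffAt ℝ (⊤ : ℕ∞) (fun z => framePhase z ^ s * f axisRot (stereo z)) z := by
        refine (contDiffAt_zpow_comp (contDiffAt_framePhase hz1) ?_ s).mul
          (contDiffAt_spin_comp axisRot_mem (hsmooth _ axisRot_mem) contDiff_stereo dot3_stereo
            ((mem_chartU_axisRot (dot3_stereo z)).2 (stereo_axis_pos hz1)))
        simp [framePhase, hz, stereo]
      refine this.congr_of_eventuallyEq ?_
      filter_upwards [(isOpen_lt continuous_norm continuous_const).mem_nhds hz1] with y hy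
      exact if_pos hy
    · have : ContDiffAt ℝ (⊤ : ℕ∞) (fun z : ℂ => (z / ‖z‖) ^ s * f 1 (stereo z)) z :=
        (contDiffAt_unit_phase hz s).mul
          (contDiffAt_spin_comp one_mem_SO3set (hsmooth _ one_mem_SO3set) contDiff_stereo
            dot3_stereo ((mem_chartU_one (dot3_stereo z)).2 (stereo_pole_pos hz)))
      refine this.congr_of_eventuallyEq ?_
      filter_upwards [isOpen_ne.mem_nhds hz] with y hy
      exact hev y hy
  · intro θ hθ φ
    have ht := (sin_cos_tan_half hθ).1
    have ht' : ((Real.tan (θ / 2) : ℝ) : ℂ) ≠ 0 := by exact_mod_cast ht.ne'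
    simp only
    rw [hev _ (mul_ne_zero ht' (Complex.exp_ne_zero _)), stereo_tan_half hθ, norm_mul,
      mul_comm Complex.I (φ : ℂ), Complex.norm_exp_ofReal_mul_I, mul_one, Complex.norm_real,
      Real.norm_eq_abs, abs_of_pos ht, mul_div_cancel_left₀ _ ht', ← mul_assoc,
      ← Complex.exp_int_mul, ← Complex.exp_add,
      show -(Complex.I * s * φ) + s * ((φ : ℂ) * Complex.I) = 0 by ring, Complex.exp_zero, one_mul]

/-- The reflection in the equatorial plane. -/
def mirror : Matrix (Fin 3) (Fin 3) ℝ := Matrix.diagonal ![1, 1, -1]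

theorem reflection_transpose : mirror.transpose = mirror := Matrix.diagonal_transpose _

theorem reflection_mul_self : mirror * mirror = 1 := by
  rw [mirror, Matrix.diagonal_mul_diagonal, ← Matrix.diagonal_one]
  congr 1
  ext i; fin_cases i <;> simp

theorem reflection_mulVec (p : Fin 3 → ℝ) : Matrix.mulVec mirror p = ![p 0, p 1, -p 2] := by
  ext i; fin_cases i <;> simp [mirror, Matrix.mulVec_diagonal]

theorem reflection_conj_mem {R : Matrix (Fin 3) (Fin 3) ℝ} (hR : R ∈ SO3set) :
    mirror * R * mirror ∈ SO3set := by
  refine ⟨?_, ?_⟩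
  · rw [Matrix.transpose_mul, Matrix.transpose_mul, reflection_transpose]
    calc mirror * R * mirror * (mirror * (R.transpose * mirror)) = mirror * (R * (mirror * mirror) * R.transpose) * mirror := by
          simp only [Matrix.mul_assoc]
      _ = 1 := by rw [reflection_mul_self, Matrix.mul_one, hR.1, Matrix.mul_one,
        reflection_mul_self]
  · have h := congrArg Matrix.det reflection_mul_self
    rw [Matrix.det_mul, Matrix.det_one] at h
    rw [Matrix.det_mul, Matrix.det_mul, hR.2, mul_one, h]

theorem mulVec_reflection_conj (R : Matrix (Fin 3) (Fin 3) ℝ) (p : Fin 3 → ℝ) :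
    Matrix.mulVec (mirror * R * mirror) (Matrix.mulVec mirror p) = Matrix.mulVec mirror (Matrix.mulVec R p) := by
  rw [Matrix.mulVec_mulVec, Matrix.mulVec_mulVec, Matrix.mul_assoc, reflection_mul_self,
    Matrix.mul_one]

theorem reflection_conj_transpose (R : Matrix (Fin 3) (Fin 3) ℝ) :
    (mirror * R * mirror).transpose = mirror * R.transpose * mirror := by
  rw [Matrix.transpose_mul, Matrix.transpose_mul, reflection_transpose, Matrix.mul_assoc]

theorem reflection_mem_UI {p : Fin 3 → ℝ} (hp : p ∈ UI) : Matrix.mulVec mirror p ∈ UI := by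
  have h : dot3 (Matrix.mulVec mirror p) (Matrix.mulVec mirror p) = 1 := by
    rw [← hp.1, reflection_mulVec]; simp [dot3]
  rw [mem_UI_iff h, reflection_mulVec]
  simpa using (mem_UI_iff hp.1).1 hp

theorem rhoI_reflection (p : Fin 3 → ℝ) :
    rhoI (Matrix.mulVec mirror p) = Matrix.mulVec mirror (rhoI p) := by
  rw [reflection_mulVec, reflection_mulVec, rhoI, rhoI]
  ext i; fin_cases i <;> simp

theorem rhoR_reflection (R : Matrix (Fin 3) (Fin 3) ℝ) (p : Fin 3 → ℝ) :
    rhoR (mirror * R * mirror) (Matrix.mulVec mirror p) = Matrix.mulVec mirror (rhoR R p) := by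
  rw [rhoR, rhoR, reflection_conj_transpose, mulVec_reflection_conj, rhoI_reflection,
    mulVec_reflection_conj]

theorem cross_reflection (v w : Fin 3 → ℝ) :
    crossProduct (Matrix.mulVec mirror v) (Matrix.mulVec mirror w) =
      -Matrix.mulVec mirror (crossProduct v w) := by
  rw [reflection_mulVec, reflection_mulVec, reflection_mulVec]
  ext i; fin_cases i <;> simp [crossProduct] <;> ring

theorem IsSpinFamily.reflect {s : ℤ} {f : Matrix (Fin 3) (Fin 3) ℝ → (Fin 3 → ℝ) → ℂ}
    (hspin : IsSpinFamily s f) :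
    IsSpinFamily (-s) fun R p => f (mirror * R * mirror) (Matrix.mulVec mirror p) := by
  intro R₁ h₁ R₂ h₂ p hp ψ hψ h
  have hmem : ∀ {R}, p ∈ chartU R → Matrix.mulVec mirror p ∈ chartU (mirror * R * mirror) := fun {R} hR => by
    change Matrix.mulVec (mirror * R * mirror).transpose (Matrix.mulVec mirror p) ∈ UI
    rw [reflection_conj_transpose, mulVec_reflection_conj]
    exact reflection_mem_UI hR
  have hlaw := congrArg (Matrix.mulVec mirror) h
  rw [Matrix.mulVec_add, Matrix.mulVec_smul, Matrix.mulVec_smul, ← rhoR_reflection,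
    ← rhoR_reflection, ← neg_neg (Matrix.mulVec mirror (crossProduct _ _)), ← cross_reflection,
    ← rhoR_reflection, smul_neg, ← neg_smul] at hlaw
  rcases hψ.2.eq_or_lt with rfl | hlt
  · simp only
    rw [hspin _ (reflection_conj_mem h₁) _ (reflection_conj_mem h₂) _ ⟨hmem hp.1, hmem hp.2⟩ _ hψ
      (by rw [hlaw, Real.sin_pi, neg_zero])]
    congr 1
    rw [Complex.exp_eq_exp_iff_exists_int]
    exact ⟨s, by push_cast; ring⟩
  · simp only
    rw [hspin _ (reflection_conj_mem h₁) _ (reflection_conj_mem h₂) _ ⟨hmem hp.1, hmem hp.2⟩ (-ψ)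
      ⟨by linarith, by linarith [hψ.1]⟩ (by rw [hlaw, Real.cos_neg, Real.sin_neg])]
    push_cast
    congr 2
    ring

theorem reflection_sphCoords (θ φ : ℝ) :
    Matrix.mulVec mirror (sphCoords θ φ) = sphCoords (Real.pi - θ) φ := by
  rw [reflection_mulVec]
  ext i; fin_cases i <;> simp [sphCoords]

theorem spin_of_spinFamily {s : ℤ} {f : Matrix (Fin 3) (Fin 3) ℝ → (Fin 3 → ℝ) → ℂ}
    (hsmooth : ∀ R ∈ SO3set, ContDiffOn ℝ (⊤ : ℕ∞)
      (fun x : ℝ × ℝ => f R (Matrix.mulVec R (sphCoords x.1 x.2)))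
      (Set.Ioo 0 Real.pi ×ˢ Set.univ))
    (hspin : IsSpinFamily s f) : Spin s fun x => f 1 (sphCoords x.1 x.2) := by
  refine ⟨north_of_spinFamily hsmooth hspin, ?_⟩
  have h := north_of_spinFamily (f := fun R p => f (mirror * R * mirror) (Matrix.mulVec mirror p)) ?_
    hspin.reflect
  · simp only [Matrix.mul_one, reflection_mul_self, reflection_sphCoords] at h
    exact h
  · intro R hR
    simp only [← mulVec_reflection_conj, reflection_sphCoords]
    exact (hsmooth _ (reflection_conj_mem hR)).comp
      (f := fun x : ℝ × ℝ => (Real.pi - x.1, x.2))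
      ((contDiff_const.sub contDiff_fst).prodMk contDiff_snd).contDiffOn
      fun x hx => ⟨pi_sub_mem hx.1, trivial⟩

/-- The degree-`l` part of an expansion with coefficients `c`, differentiated `i` times in `θ` and
`j` times in `φ`. -/
def level (c : ℤ → ℤ → ℂ) (s : ℤ) (i j : ℕ) (l : ℤ) (x : ℝ × ℝ) : ℂ :=
  ∑ m ∈ Finset.Icc (-l) l, c l m * (Complex.I * m) ^ j *
    ((iteratedDeriv i (polarY l s m) x.1 : ℝ) : ℂ) * Complex.exp (Complex.I * m * x.2)

/-- Decay of the coefficients faster than any power of the degree. -/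
def RapidDecay (s : ℤ) (c : ℤ → ℤ → ℂ) : Prop :=
  ∀ N : ℕ, ∃ C : ℝ, 0 ≤ C ∧ ∀ l m : ℤ, |s| ≤ l → ‖c l m‖ ≤ C * ((l : ℝ) + 1) ^ (-(N : ℤ))

/-- The full expansion with coefficients `c`, differentiated termwise. -/
def levelSum (c : ℤ → ℤ → ℂ) (s : ℤ) (i j : ℕ) (x : ℝ × ℝ) : ℂ :=
  ∑' k : ℕ, level c s i j (|s| + k) x

theorem norm_exp_azimuth (m : ℤ) (φ : ℝ) : ‖Complex.exp (Complex.I * m * φ)‖ = 1 := by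
  rw [show Complex.I * m * φ = ((m * φ : ℝ) : ℂ) * Complex.I by push_cast; ring,
    Complex.norm_exp_ofReal_mul_I]

theorem summable_shifted_sq (C : ℝ) : Summable fun k : ℕ => C * (((k : ℝ) + 1) ^ 2)⁻¹ := by
  have := (summable_nat_add_iff 1).2 (Real.summable_nat_pow_inv.2 one_lt_two)
  simpa using this.mul_left C

theorem RapidDecay.exists_bound_level {s : ℤ} {c : ℤ → ℤ → ℂ} (hc : RapidDecay s c) (i j : ℕ) :
    ∃ b : ℕ → ℝ, Summable b ∧ ∀ (k : ℕ) x, ‖level c s i j (|s| + k) x‖ ≤ b k := by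
  obtain ⟨C, hC, h⟩ := hc (i + j + 4)
  refine ⟨fun k => 2 * C * (((k : ℝ) + 1) ^ 2)⁻¹, summable_shifted_sq _, fun k x => ?_⟩
  obtain ⟨l, hl⟩ : ∃ l : ℤ, l = |s| + k := ⟨_, rfl⟩
  rw [← hl]
  have hsl : |s| ≤ l := by omega
  have hl0 : 0 ≤ l := (abs_nonneg s).trans hsl
  have hl0' : (0 : ℝ) ≤ l := by exact_mod_cast hl0
  have hkl : (k : ℝ) ≤ l := by
    have : (k : ℤ) ≤ l := by linarith [abs_nonneg s]
    exact_mod_cast this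
  have hterm : ∀ m ∈ Finset.Icc (-l) l, ‖c l m * (Complex.I * m) ^ j *
      ((iteratedDeriv i (polarY l s m) x.1 : ℝ) : ℂ) * Complex.exp (Complex.I * m * x.2)‖ ≤
      C * (((l : ℝ) + 1) ^ 3)⁻¹ := fun m hm => by
    have hm' : |(m : ℝ)| ≤ l + 1 := by
      have : |m| ≤ l := abs_le.2 (Finset.mem_Icc.1 hm)
      have : |(m : ℝ)| ≤ l := by exact_mod_cast this
      linarith
    rw [norm_mul, norm_mul, norm_mul, norm_exp_azimuth, mul_one, norm_pow, norm_mul,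
      Complex.norm_I, one_mul, Complex.norm_intCast, Complex.norm_real, Real.norm_eq_abs]
    calc _ ≤ (C * ((l : ℝ) + 1) ^ (-((i + j + 4 : ℕ) : ℤ))) * ((l : ℝ) + 1) ^ j *
          ((l : ℝ) + 1) ^ (i + 1) :=
          mul_le_mul (mul_le_mul (h l m hsl) (pow_le_pow_left₀ (abs_nonneg _) hm' j)
            (by positivity) (by positivity)) (abs_iteratedDeriv_polarY_le hl0 s m i x.1)
            (abs_nonneg _) (by positivity)
      _ = _ := by
          rw [zpow_neg, zpow_natCast]
          field_simp
          ring
  calc _ ≤ ∑ m ∈ Finset.Icc (-l) l, C * (((l : ℝ) + 1) ^ 3)⁻¹ := norm_sum_le_of_le _ hterm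
    _ = (2 * l + 1) * (C * (((l : ℝ) + 1) ^ 3)⁻¹) := by
        rw [Finset.sum_const, Int.card_Icc, nsmul_eq_mul]
        congr 1
        have : (((l + 1 - -l).toNat : ℕ) : ℤ) = 2 * l + 1 := by omega
        exact_mod_cast congrArg (fun z : ℤ => (z : ℝ)) this
    _ ≤ (2 * (l + 1)) * (C * (((l : ℝ) + 1) ^ 3)⁻¹) :=
        mul_le_mul_of_nonneg_right (by linarith) (by positivity)
    _ = 2 * C * (((l : ℝ) + 1) ^ 2)⁻¹ := by field_simp
    _ ≤ 2 * C * (((k : ℝ) + 1) ^ 2)⁻¹ := by gcongr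

theorem hasDerivAt_level_fst (c : ℤ → ℤ → ℂ) (s : ℤ) (i j : ℕ) (l : ℤ) (θ φ : ℝ) :
    HasDerivAt (fun t => level c s i j l (t, φ)) (level c s (i + 1) j l (θ, φ)) θ := by
  refine HasDerivAt.fun_sum fun m _ => ?_
  have h : HasDerivAt (iteratedDeriv i (polarY l s m)) (iteratedDeriv (i + 1) (polarY l s m) θ) θ := by
    rw [iteratedDeriv_succ]
    exact ((contDiff_polarY l s m).differentiable_iteratedDeriv i
      (by exact_mod_cast WithTop.coe_lt_top _) θ).hasDerivAt
  exact (h.ofReal_comp.const_mul (c l m * (Complex.I * m) ^ j)).mul_const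
    (Complex.exp (Complex.I * m * φ))

theorem hasDerivAt_level_snd (c : ℤ → ℤ → ℂ) (s : ℤ) (i j : ℕ) (l : ℤ) (θ φ : ℝ) :
    HasDerivAt (fun t => level c s i j l (θ, t)) (level c s i (j + 1) l (θ, φ)) φ := by
  refine HasDerivAt.fun_sum fun m _ => ?_
  have h : HasDerivAt (fun t : ℝ => Complex.exp (Complex.I * m * t))
      (Complex.exp (Complex.I * m * φ) * (Complex.I * m)) φ := by
    simpa using ((Complex.ofRealCLM.hasDerivAt (x := φ)).const_mul (Complex.I * (m : ℂ))).cexp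
  refine (h.const_mul (c l m * (Complex.I * m) ^ j *
    ((iteratedDeriv i (polarY l s m) θ : ℝ) : ℂ))).congr_deriv ?_
  ring

theorem RapidDecay.pdθ_levelSum {s : ℤ} {c : ℤ → ℤ → ℂ} (hc : RapidDecay s c) (i j : ℕ) :
    pdθ (levelSum c s i j) = levelSum c s (i + 1) j := by
  funext x
  obtain ⟨b, hb, hbound⟩ := hc.exists_bound_level (i + 1) j
  obtain ⟨b', hb', hbound'⟩ := hc.exists_bound_level i j
  exact (hasDerivAt_tsum (y₀ := x.1) hb
    (fun k t => hasDerivAt_level_fst c s i j (|s| + k) t x.2) (fun k t => hbound k (t, x.2))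
    (Summable.of_norm_bounded hb' fun k => hbound' k x) x.1).deriv

theorem RapidDecay.pdφ_levelSum {s : ℤ} {c : ℤ → ℤ → ℂ} (hc : RapidDecay s c) (i j : ℕ) :
    pdφ (levelSum c s i j) = levelSum c s i (j + 1) := by
  funext x
  obtain ⟨b, hb, hbound⟩ := hc.exists_bound_level i (j + 1)
  obtain ⟨b', hb', hbound'⟩ := hc.exists_bound_level i j
  exact (hasDerivAt_tsum (y₀ := x.2) hb
    (fun k t => hasDerivAt_level_snd c s i j (|s| + k) x.1 t) (fun k t => hbound k (x.1, t))
    (Summable.of_norm_bounded hb' fun k => hbound' k x) x.2).deriv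

theorem iterate_pd_eq {T : ℕ → ℕ → ℝ × ℝ → ℂ} (hθ : ∀ i j, pdθ (T i j) = T (i + 1) j)
    (hφ : ∀ i j, pdφ (T i j) = T i (j + 1)) (i j : ℕ) : pdθ^[i] (pdφ^[j] (T 0 0)) = T i j := by
  have h1 : ∀ j, pdφ^[j] (T 0 0) = T 0 j := fun j => by
    induction j with
    | zero => rfl
    | succ j ih => rw [Function.iterate_succ_apply', ih, hφ]
  induction i with
  | zero => exact h1 j
  | succ i ih => rw [Function.iterate_succ_apply', ih, hθ]

theorem RapidDecay.iterate_pd_levelSum {s : ℤ} {c : ℤ → ℤ → ℂ} (hc : RapidDecay s c) (i j : ℕ) :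
    pdθ^[i] (pdφ^[j] (levelSum c s 0 0)) = levelSum c s i j :=
  iterate_pd_eq hc.pdθ_levelSum hc.pdφ_levelSum i j

theorem iterate_pd_sum_level (c : ℤ → ℤ → ℂ) (s : ℤ) (S : Finset ℤ) (i j : ℕ) :
    pdθ^[i] (pdφ^[j] fun x => ∑ l ∈ S, level c s 0 0 l x) = fun x => ∑ l ∈ S, level c s i j l x :=
  iterate_pd_eq (T := fun i j x => ∑ l ∈ S, level c s i j l x)
    (fun i j => funext fun x =>
      (HasDerivAt.fun_sum fun l _ => hasDerivAt_level_fst c s i j l x.1 x.2).deriv)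
    (fun i j => funext fun x =>
      (HasDerivAt.fun_sum fun l _ => hasDerivAt_level_snd c s i j l x.1 x.2).deriv) i j

theorem iterate_pd_congr {u v : ℝ × ℝ → ℂ}
    (h : Set.EqOn u v (Set.Ioo 0 Real.pi ×ˢ Set.univ)) (i j : ℕ) :
    Set.EqOn (pdθ^[i] (pdφ^[j] u)) (pdθ^[i] (pdφ^[j] v)) (Set.Ioo 0 Real.pi ×ˢ Set.univ) := by
  have h1 : ∀ j, Set.EqOn (pdφ^[j] u) (pdφ^[j] v) (Set.Ioo 0 Real.pi ×ˢ Set.univ) := fun j => by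
    induction j with
    | zero => exact h
    | succ j ih =>
      rw [Function.iterate_succ_apply', Function.iterate_succ_apply']
      intro x hx
      exact congrArg (deriv · x.2) (funext fun t => ih (x := (x.1, t)) ⟨hx.1, trivial⟩)
  induction i with
  | zero => exact h1 j
  | succ i ih =>
    rw [Function.iterate_succ_apply', Function.iterate_succ_apply']
    intro x hx
    exact deriv_congr_Ioo hx.1 fun t ht => ih (x := (t, x.2)) ⟨ht, trivial⟩

theorem sum_Icc_eq_sum_range_shift {M : Type*} [AddCommMonoid M] (a L : ℤ) (F : ℤ → M) :
    ∑ l ∈ Finset.Icc a L, F l = ∑ k ∈ Finset.range (L + 1 - a).toNat, F (a + k) := by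
  symm
  refine Finset.sum_bij (fun k _ => a + (k : ℤ)) ?_ ?_ ?_ ?_
  · intro k hk; rw [Finset.mem_range] at hk; rw [Finset.mem_Icc]; omega
  · intro k _ k' _ h; omega
  · intro l hl
    rw [Finset.mem_Icc] at hl
    exact ⟨(l - a).toNat, by rw [Finset.mem_range]; omega, by omega⟩
  · intro k _; rfl

theorem RapidDecay.tendstoUniformly {s : ℤ} {c : ℤ → ℤ → ℂ} (hc : RapidDecay s c) (i j : ℕ) :
    TendstoUniformly (fun (L : ℤ) x => ∑ l ∈ Finset.Icc |s| L, level c s i j l x)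
      (levelSum c s i j) Filter.atTop := by
  obtain ⟨b, hb, hbound⟩ := hc.exists_bound_level i j
  have h := tendstoUniformly_tsum_nat hb hbound
  have ht : Filter.Tendsto (fun L : ℤ => (L + 1 - |s|).toNat) Filter.atTop Filter.atTop := by
    refine Filter.tendsto_atTop.2 fun n => ?_
    filter_upwards [Filter.eventually_ge_atTop (n + |s|)] with L hL
    omega
  intro U hU
  filter_upwards [ht.eventually (h U hU)] with L hL x
  rw [sum_Icc_eq_sum_range_shift]
  exact hL x

theorem mode_exp_azimuth (m n : ℤ) :
    ∫ φ in (-Real.pi)..Real.pi, Complex.exp (Complex.I * n * φ) *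
      Complex.exp (-(Complex.I * m * φ)) = if n = m then (2 * Real.pi : ℂ) else 0 := by
  have h : ∀ φ : ℝ, Complex.exp (Complex.I * n * φ) * Complex.exp (-(Complex.I * m * φ)) =
      Complex.exp (Complex.I * (n - m) * φ) := fun φ => by
    rw [← Complex.exp_add]; ring_nf
  simp only [h]
  split_ifs with hnm
  · subst hnm
    simp
    ring
  · have hc : Complex.I * ((n : ℂ) - m) ≠ 0 :=
      mul_ne_zero Complex.I_ne_zero (sub_ne_zero.2 (by exact_mod_cast hnm))
    rw [integral_exp_mul_complex hc, div_eq_zero_iff, sub_eq_zero]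
    left
    refine Complex.exp_eq_exp_iff_exists_int.2 ⟨n - m, ?_⟩
    push_cast
    ring

theorem norm_mode_le {u : ℝ × ℝ → ℂ} {M θ : ℝ} (m : ℤ) (h : ∀ φ, ‖u (θ, φ)‖ ≤ M) :
    ‖mode m u θ‖ ≤ M * (2 * Real.pi) := by
  have := intervalIntegral.norm_integral_le_of_norm_le_const (a := -Real.pi) (b := Real.pi)
    (f := fun φ => u (θ, φ) * Complex.exp (-(Complex.I * m * φ))) (C := M) fun φ _ => by
      rw [norm_mul, norm_exp_mode, mul_one]
      exact h φ
  rw [abs_of_nonneg (by linarith [Real.pi_pos])] at this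
  exact this.trans_eq (by ring)

theorem continuous_level (c : ℤ → ℤ → ℂ) (s : ℤ) (i j : ℕ) (l : ℤ) :
    Continuous (level c s i j l) := by
  refine continuous_finsetSum _ fun m _ => ?_
  have := ((contDiff_polarY l s m).continuous_iteratedDeriv i (by exact_mod_cast le_top)).comp
    (continuous_fst (X := ℝ) (Y := ℝ))
  exact (continuous_const.mul (Complex.continuous_ofReal.comp this)).mul (by fun_prop)

theorem RapidDecay.continuous_levelSum {s : ℤ} {c : ℤ → ℤ → ℂ} (hc : RapidDecay s c) (i j : ℕ) :
    Continuous (levelSum c s i j) := by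
  obtain ⟨b, hb, hbound⟩ := hc.exists_bound_level i j
  exact continuous_tsum (fun k => continuous_level c s i j _) hb hbound

theorem mode_level (c : ℤ → ℤ → ℂ) (s m l : ℤ) (θ : ℝ) :
    mode m (level c s 0 0 l) θ = 2 * Real.pi * c l m * (polarY l s m θ : ℂ) := by
  have h1 : ∀ φ : ℝ, level c s 0 0 l (θ, φ) * Complex.exp (-(Complex.I * m * φ)) =
      ∑ n ∈ Finset.Icc (-l) l, c l n * (polarY l s n θ : ℂ) *
        (Complex.exp (Complex.I * n * φ) * Complex.exp (-(Complex.I * m * φ))) := fun φ => by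
    rw [level, Finset.sum_mul]
    refine Finset.sum_congr rfl fun n _ => ?_
    rw [pow_zero, iteratedDeriv_zero]
    ring
  rw [mode]
  simp only [h1]
  rw [intervalIntegral.integral_finsetSum fun n _ =>
    Continuous.intervalIntegrable (by fun_prop) _ _]
  simp only [intervalIntegral.integral_const_mul, mode_exp_azimuth, mul_ite, mul_zero]
  rw [Finset.sum_ite_eq']
  split_ifs with hm
  · ring
  · rw [polarY_of_not, Complex.ofReal_zero, mul_zero]
    exact fun h => hm (Finset.mem_Icc.2 (abs_le.1 h.2))

theorem RapidDecay.hasSum_mode {s : ℤ} {c : ℤ → ℤ → ℂ} (hc : RapidDecay s c) (m : ℤ) (θ : ℝ) :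
    HasSum (fun k : ℕ => mode m (level c s 0 0 (|s| + k)) θ) (mode m (levelSum c s 0 0) θ) := by
  obtain ⟨b, hb, hbound⟩ := hc.exists_bound_level 0 0
  refine intervalIntegral.hasSum_integral_of_dominated_convergence (fun k _ => b k)
    (fun k => ?_) (fun k => ?_) ?_ ?_ ?_
  · have := continuous_level c s 0 0 (|s| + k)
    exact Continuous.aestronglyMeasurable (by fun_prop)
  · refine Filter.Eventually.of_forall fun φ _ => ?_
    rw [norm_mul, norm_exp_mode, mul_one]
    exact hbound k _
  · exact Filter.Eventually.of_forall fun φ _ => hb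
  · exact intervalIntegrable_const
  · exact Filter.Eventually.of_forall fun φ _ =>
      (Summable.of_norm_bounded hb fun k => hbound k _).hasSum.mul_right _

theorem hasSum_pair {F : ℕ → ℝ → ℂ} {b : ℕ → ℝ} (hF : ∀ k, Continuous (F k)) (hb : Summable b)
    (hbound : ∀ k θ, ‖F k θ‖ ≤ b k) (l s m : ℤ) :
    HasSum (fun k => pair (F k) l s m) (pair (fun θ => ∑' k, F k θ) l s m) := by
  have hp : Continuous fun θ => (polarY l s m θ : ℂ) :=
    Complex.continuous_ofReal.comp (continuous_polarY l s m)
  refine intervalIntegral.hasSum_integral_of_dominated_convergence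
    (fun k θ => b k * ‖(polarY l s m θ : ℂ)‖) (fun k => ?_) (fun k => ?_) ?_ ?_ ?_
  · have := hF k
    exact Continuous.aestronglyMeasurable (by fun_prop)
  · refine Filter.Eventually.of_forall fun θ _ => ?_
    rw [norm_mul, norm_mul]
    refine (mul_le_of_le_one_right (by positivity) ?_).trans
      (mul_le_mul_of_nonneg_right (hbound k θ) (norm_nonneg _))
    rw [Complex.norm_real]
    exact Real.abs_sin_le_one θ
  · exact Filter.Eventually.of_forall fun θ _ => hb.mul_right _
  · simp only [tsum_mul_right]
    exact Continuous.intervalIntegrable (by fun_prop) _ _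
  · exact Filter.Eventually.of_forall fun θ _ =>
      ((Summable.of_norm_bounded hb fun k => hbound k θ).hasSum.mul_right _).mul_right _

theorem pair_const_mul (a : ℂ) (h : ℝ → ℂ) (l s m : ℤ) :
    pair (fun θ => a * h θ) l s m = a * pair h l s m := by
  simp only [pair, mul_assoc, intervalIntegral.integral_const_mul]

theorem pair_sub {h g : ℝ → ℂ} (hh : BddCont h) (hg : BddCont g) (l s m : ℤ) :
    pair (fun θ => h θ - g θ) l s m = pair h l s m - pair g l s m := by
  rw [pair, pair, pair, ← intervalIntegral.integral_sub (hh.intervalIntegrable_pair l s m)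
    (hg.intervalIntegrable_pair l s m)]
  simp only [sub_mul]

theorem RapidDecay.mode_levelSum {s : ℤ} {c : ℤ → ℤ → ℂ} (hc : RapidDecay s c) (m : ℤ) :
    Continuous (mode m (levelSum c s 0 0)) ∧ ∀ l, |s| ≤ l → |m| ≤ l →
      pair (mode m (levelSum c s 0 0)) l s m = c l m := by
  obtain ⟨b, hb, hbound⟩ := hc.exists_bound_level 0 0
  have hsum : mode m (levelSum c s 0 0) =
      fun θ => ∑' k : ℕ, mode m (level c s 0 0 (|s| + k)) θ :=
    funext fun θ => (hc.hasSum_mode m θ).tsum_eq.symm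
  have hcont : ∀ k : ℕ, Continuous (mode m (level c s 0 0 (|s| + k))) := fun k => by
    rw [funext (mode_level c s m (|s| + k))]
    exact continuous_const.mul (Complex.continuous_ofReal.comp (continuous_polarY _ s m))
  have hbd : ∀ (k : ℕ) θ, ‖mode m (level c s 0 0 (|s| + k)) θ‖ ≤ b k * (2 * Real.pi) :=
    fun k θ => norm_mode_le m fun φ => hbound k _
  rw [hsum]
  refine ⟨continuous_tsum hcont (hb.mul_right _) hbd, fun l hs hm => ?_⟩
  obtain ⟨k₀, rfl⟩ : ∃ k₀ : ℕ, l = |s| + k₀ := ⟨(l - |s|).toNat, by omega⟩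
  rw [← (hasSum_pair hcont (hb.mul_right _) hbd (|s| + k₀) s m).tsum_eq, tsum_eq_single k₀]
  · rw [funext (mode_level c s m (|s| + k₀)), pair_const_mul, pair_polarY_self hs hm]
    have : (Real.pi : ℂ) ≠ 0 := by exact_mod_cast Real.pi_ne_zero
    field_simp
  · intro k hk
    rw [funext (mode_level c s m (|s| + k)), pair_const_mul,
      pair_polarY_of_ne m (by omega) hs (by omega), mul_zero]

theorem eq_zero_of_fourier_eq_zero {H : ℝ → ℂ} (hH : Continuous H)
    (hper : Function.Periodic H (2 * Real.pi))
    (h0 : ∀ m : ℤ, ∫ φ in (-Real.pi)..Real.pi, H φ * Complex.exp (-(Complex.I * m * φ)) = 0)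
    (φ : ℝ) : H φ = 0 := by
  have : Fact (0 < 2 * Real.pi) := ⟨Real.two_pi_pos⟩
  let G : C(AddCircle (2 * Real.pi), ℂ) := ⟨hper.lift, continuous_coinduced_dom.2 hH⟩
  have hG : ∀ φ : ℝ, G (φ : AddCircle (2 * Real.pi)) = H φ := fun φ => rfl
  have hcoeff : fourierCoeff G = 0 := by
    funext m
    rw [fourierCoeff_eq_intervalIntegral G m (-Real.pi),
      show -Real.pi + 2 * Real.pi = Real.pi by ring]
    have h : ∀ φ : ℝ, fourier (-m) (φ : AddCircle (2 * Real.pi)) • G φ =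
        H φ * Complex.exp (-(Complex.I * m * φ)) := fun φ => by
      rw [fourier_coe_apply, hG, smul_eq_mul, mul_comm]
      congr 2
      have : (Real.pi : ℂ) ≠ 0 := by exact_mod_cast Real.pi_ne_zero
      push_cast
      field_simp
    simp only [h, h0, smul_zero, Pi.zero_apply]
  have hs := has_pointwise_sum_fourier_series_of_summable (f := G)
    (by rw [hcoeff]; exact summable_zero) (φ : AddCircle (2 * Real.pi))
  simp only [hcoeff, Pi.zero_apply, zero_smul] at hs
  exact (hG φ).symm.trans (hs.unique hasSum_zero)

theorem levelSum_periodic (c : ℤ → ℤ → ℂ) (s : ℤ) (i j : ℕ) (θ : ℝ) :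
    Function.Periodic (fun φ => levelSum c s i j (θ, φ)) (2 * Real.pi) := fun φ => by
  refine tsum_congr fun k => Finset.sum_congr rfl fun m _ => ?_
  have : Complex.exp (Complex.I * m * ((φ + 2 * Real.pi : ℝ) : ℂ)) =
      Complex.exp (Complex.I * m * φ) :=
    Complex.exp_eq_exp_iff_exists_int.2 ⟨m, by push_cast; ring⟩
  simp only [this]

theorem Spin.rapidDecay {s : ℤ} {u : ℝ × ℝ → ℂ} (hu : Spin s u) :
    RapidDecay s fun l m => pair (mode m u) l s m := fun N => hu.decay N

theorem Spin.eqOn_levelSum {s : ℤ} {u : ℝ × ℝ → ℂ} (hu : Spin s u) :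
    Set.EqOn u (levelSum (fun l m => pair (mode m u) l s m) s 0 0)
      (Set.Ioo 0 Real.pi ×ˢ Set.univ) := by
  have hc := hu.rapidDecay
  set c : ℤ → ℤ → ℂ := fun l m => pair (mode m u) l s m with hcdef
  rintro ⟨θ, φ⟩ ⟨hθ, -⟩
  have hmode : ∀ m : ℤ, mode m u θ - mode m (levelSum c s 0 0) θ = 0 := fun m => by
    obtain ⟨hcont, hpair⟩ := hc.mode_levelSum m
    have h1 := hu.bddCont_mode m
    have h2 := BddCont.of_continuous hcont
    refine eq_zero_of_pair_eq_zero (s := s) (m := m) (h1.sub h2) (fun j => ?_) θ hθ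
    rw [pair_sub h1 h2, hpair _ (by omega) (by omega), sub_self]
  have hexp : ∀ m : ℤ, Continuous fun φ : ℝ => Complex.exp (-(Complex.I * m * φ)) := fun m => by
    fun_prop
  have hcu : Continuous fun φ => u (θ, φ) := continuous_slice hu.1.contDiffOn hθ
  have hcl : Continuous fun φ => levelSum c s 0 0 (θ, φ) :=
    (hc.continuous_levelSum 0 0).comp (by fun_prop)
  refine sub_eq_zero.1 (eq_zero_of_fourier_eq_zero
    (H := fun φ => u (θ, φ) - levelSum c s 0 0 (θ, φ)) (hcu.sub hcl)
    ((hu.1.periodic hθ).sub (levelSum_periodic c s 0 0 θ)) (fun m => ?_) φ)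
  have h1 := ((hcu.mul (hexp m)).intervalIntegrable (μ := MeasureTheory.volume) (-Real.pi) Real.pi)
  have h2 := ((hcl.mul (hexp m)).intervalIntegrable (μ := MeasureTheory.volume) (-Real.pi) Real.pi)
  simp only [sub_mul]
  exact (intervalIntegral.integral_sub h1 h2).trans (hmode m)

theorem integral_mul_conj_sY (g : ℝ × ℝ → ℂ) {s l m : ℤ} (hs : |s| ≤ l) (hm : |m| ≤ l) :
    (∫ θ in (0 : ℝ)..Real.pi,
      (∫ φ in (-Real.pi)..Real.pi, g (θ, φ) * (starRingEnd ℂ) (sY s l m (θ, φ))) *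
        (Real.sin θ : ℂ)) = (-1) ^ (max (-m) 0) * pair (mode m g) l s m := by
  rw [pair, ← intervalIntegral.integral_const_mul]
  refine intervalIntegral.integral_congr_Ioo_of_le Real.pi_pos.le fun θ hθ => ?_
  have h : ∀ φ : ℝ, g (θ, φ) * (starRingEnd ℂ) (sY s l m (θ, φ)) =
      (-1) ^ (max (-m) 0) * (polarY l s m θ : ℂ) *
        (g (θ, φ) * Complex.exp (-(Complex.I * m * φ))) := fun φ => by
    rw [sY_eq hs hm hθ.1 hθ.2, map_mul, map_mul, map_zpow₀, ← Complex.exp_conj]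
    simp only [map_mul, map_neg, map_one, Complex.conj_I, Complex.conj_ofReal, map_intCast]
    rw [show -Complex.I * m * φ = -(Complex.I * m * φ) by ring]
    ring
  simp only [h, intervalIntegral.integral_const_mul]
  rw [mode]
  ring

/-- **Smooth spin-`s` functions have rapidly decaying spin harmonic coefficients, and the
expansion converges in `C^∞` on compacta** (Statement 6). -/
theorem spin_smooth_expansion (s : ℤ) (f : Matrix (Fin 3) (Fin 3) ℝ → (Fin 3 → ℝ) → ℂ)
    (hsmooth : ∀ R ∈ SO3set, ContDiffOn ℝ (⊤ : ℕ∞)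
      (fun x : ℝ × ℝ => f R (Matrix.mulVec R (sphCoords x.1 x.2)))
      (Set.Ioo 0 Real.pi ×ˢ Set.univ))
    (hspin : IsSpinFamily s f) :
    let g : ℝ × ℝ → ℂ := fun x => f 1 (sphCoords x.1 x.2)
    let A : ℤ → ℤ → ℂ := fun l m =>
      ∫ θ in (0:ℝ)..Real.pi,
        (∫ φ in (-Real.pi)..Real.pi, g (θ, φ) * (starRingEnd ℂ) (sY s l m (θ, φ))) *
          (Real.sin θ : ℂ)
    (∀ N : ℕ, ∃ C : ℝ, ∀ l m : ℤ, |s| ≤ l → -l ≤ m → m ≤ l →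
      ‖A l m‖ ≤ C * ((l : ℝ) + 1) ^ (-(N : ℤ))) ∧
    (∀ i j : ℕ, ∀ K : Set (ℝ × ℝ), IsCompact K → K ⊆ Set.Ioo 0 Real.pi ×ˢ Set.univ →
      TendstoUniformlyOn
        (fun L : ℤ => pdθ^[i] (pdφ^[j] (fun y =>
          ∑ l ∈ Finset.Icc |s| L, ∑ m ∈ Finset.Icc (-l) l, A l m * sY s l m y)))
        (pdθ^[i] (pdφ^[j] g)) Filter.atTop K) := by
  intro g A
  have hg : Spin s g := spin_of_spinFamily hsmooth hspin
  have hA : ∀ {l m : ℤ}, |s| ≤ l → |m| ≤ l →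
      A l m = (-1) ^ (max (-m) 0) * pair (mode m g) l s m := integral_mul_conj_sY g
  refine ⟨fun N => ?_, fun i j K _ hK => ?_⟩
  · obtain ⟨C, -, hC⟩ := hg.decay N
    refine ⟨C, fun l m hs h1 h2 => ?_⟩
    rw [hA hs (abs_le.2 ⟨h1, h2⟩), norm_mul, norm_zpow, norm_neg, norm_one, one_zpow, one_mul]
    exact hC l m hs
  · have hc := hg.rapidDecay
    set c : ℤ → ℤ → ℂ := fun l m => pair (mode m g) l s m
    have hpartial : ∀ L : ℤ, Set.EqOn
        (fun x => ∑ l ∈ Finset.Icc |s| L, level c s 0 0 l x)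
        (fun y => ∑ l ∈ Finset.Icc |s| L, ∑ m ∈ Finset.Icc (-l) l, A l m * sY s l m y)
        (Set.Ioo 0 Real.pi ×ˢ Set.univ) := fun L x hx => by
      refine Finset.sum_congr rfl fun l hl => Finset.sum_congr rfl fun m hm => ?_
      have hs := (Finset.mem_Icc.1 hl).1
      have hm' := abs_le.2 (Finset.mem_Icc.1 hm)
      rw [hA hs hm', show x = (x.1, x.2) from rfl, sY_eq hs hm' hx.1.1 hx.1.2, pow_zero,
        iteratedDeriv_zero]
      have hsq : ((-1 : ℂ) ^ (max (-m) 0)) * (-1) ^ (max (-m) 0) = 1 := by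
        rw [← mul_zpow]; simp
      linear_combination (-(c l m * (polarY l s m x.1 : ℂ) *
        Complex.exp (Complex.I * m * x.2))) * hsq
    have hlim := (hc.tendstoUniformly i j).tendstoUniformlyOn (s := K)
    refine (hlim.congr (Filter.Eventually.of_forall fun L x hx => ?_)).congr_right fun x hx => ?_
    · rw [← iterate_pd_congr (hpartial L) i j (hK hx), iterate_pd_sum_level]
    · rw [iterate_pd_congr hg.eqOn_levelSum i j (hK hx), hc.iterate_pd_levelSum]
end
end

section
/- Let s be an integer and l ≥ |s|, −l ≤ m ≤ l. Then lim_{θ→0⁺} e^{isφ} ₛY_{lm}(θ,φ) = (−1)^{max(s,0)} √((2l+1)/(4π)) if m = −s, and the limit equals 0 if m ≠ −s; in both cases the convergence is uniform in φ ∈ ℝ. -/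
noncomputable section

open Filter Topology in
/-- For `0 ≤ k ≤ n`, `sin^n(θ/2) cot^k(θ/2)` tends to `1` if `n = k` and to `0` otherwise, as `θ → 0⁺`. -/
theorem tendsto_sin_zpow_mul_cot_zpow (n k : ℤ) (hk : 0 ≤ k) (hkn : k ≤ n) :
    Tendsto (fun θ : ℝ => ((Real.sin (θ / 2) : ℂ)) ^ n *
      ((Real.cos (θ / 2) / Real.sin (θ / 2) : ℝ) : ℂ) ^ k) (𝓝[>] 0)
      (𝓝 (if n = k then 1 else 0)) := by
  obtain ⟨q, rfl⟩ := Int.eq_ofNat_of_zero_le hk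
  obtain ⟨p, hp⟩ := Int.eq_ofNat_of_zero_le (sub_nonneg.2 hkn)
  obtain rfl : n = ((p + q : ℕ) : ℤ) := by push_cast; omega
  have hlim : Tendsto (fun θ : ℝ => ((Real.sin (θ / 2) : ℂ)) ^ p * ((Real.cos (θ / 2) : ℂ)) ^ q)
      (𝓝[>] 0) (𝓝 (if ((p + q : ℕ) : ℤ) = q then 1 else 0)) := by
    have hc : Continuous
        (fun θ : ℝ => ((Real.sin (θ / 2) : ℂ)) ^ p * ((Real.cos (θ / 2) : ℂ)) ^ q) := by
      fun_prop
    convert (hc.tendsto 0).mono_left nhdsWithin_le_nhds using 2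
    by_cases h : p = 0 <;> simp [h]
  refine hlim.congr' ?_
  filter_upwards [Ioo_mem_nhdsGT (show (0 : ℝ) < 1 by norm_num)] with θ hθ
  have hsin : (Real.sin (θ / 2) : ℂ) ≠ 0 := by
    refine Complex.ofReal_ne_zero.2 (Real.sin_pos_of_pos_of_lt_pi ?_ ?_).ne'
    · linarith [hθ.1]
    · linarith [hθ.2, Real.pi_gt_three]
  rw [zpow_natCast, zpow_natCast, Complex.ofReal_div, div_pow, pow_add]
  field_simp

open Filter Topology in
/-- The limit of each summand in the definition of `ₛY_{lm}`. -/
theorem tendsto_sY_summand (s l m r : ℤ) :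
    Tendsto (fun θ : ℝ => ((Real.sin (θ / 2) : ℂ)) ^ (2 * l) *
      ((izbinom (l - s) r : ℂ) * (izbinom (l + s) (r + s - m) : ℂ) * (-1 : ℂ) ^ (l - r - s) *
        ((Real.cos (θ / 2) / Real.sin (θ / 2) : ℝ) : ℂ) ^ (2 * r + s - m))) (𝓝[>] 0)
      (𝓝 (if r = l - s then (if m = -s ∧ |s| ≤ l then 1 else 0) else 0)) := by
  by_cases h : (0 ≤ r ∧ r ≤ l - s) ∧ (0 ≤ r + s - m ∧ r + s - m ≤ l + s)
  · obtain ⟨⟨h1, h2⟩, h3, h4⟩ := h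
    have ht := (tendsto_sin_zpow_mul_cot_zpow (2 * l) (2 * r + s - m) (by omega)
      (by omega)).const_mul
        ((izbinom (l - s) r : ℂ) * (izbinom (l + s) (r + s - m) : ℂ) * (-1 : ℂ) ^ (l - r - s))
    convert ht using 2
    · ring
    · by_cases hr : r = l - s
      · by_cases hms : m = -s
        · subst hr hms
          have hs : |s| ≤ l := abs_le.2 ⟨by omega, by omega⟩
          rw [if_pos rfl, if_pos ⟨rfl, hs⟩, if_pos (by ring),
            show l - s + s - -s = l + s by ring, show l - (l - s) - s = 0 by ring]
          simp [izbinom, show s ≤ l by omega, show 0 ≤ l + s by omega]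
        · rw [if_pos hr, if_neg (fun h => hms h.1), if_neg (by omega), mul_zero]
      · rw [if_neg hr, if_neg (by omega), mul_zero]
  · have hz : (izbinom (l - s) r : ℂ) * (izbinom (l + s) (r + s - m) : ℂ) = 0 := by
      rcases not_and_or.1 h with h | h <;> simp only [izbinom, if_neg h, Nat.cast_zero, zero_mul,
        mul_zero]
    have hif : (if r = l - s then (if m = -s ∧ |s| ≤ l then (1 : ℂ) else 0) else 0) = 0 := by
      split_ifs with hr hm
      · have := abs_le.1 hm.2
        exact absurd ⟨⟨by omega, by omega⟩, by omega, by omega⟩ h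
      · rfl
      · rfl
    simp only [hif, hz, zero_mul, mul_zero]
    exact tendsto_const_nhds

/-- For `m = -s` the normalization of `ₛY_{lm}` reduces to `√((2l+1)/(4π))`. -/
theorem alm_neg_div_sqrt (s l : ℤ) :
    alm l (-s) / Real.sqrt (((l + s).toNat.factorial : ℝ) * ((l - s).toNat.factorial : ℝ)) =
      Real.sqrt ((2 * (l : ℝ) + 1) / (4 * Real.pi)) := by
  have hpos : (0 : ℝ) < ((l + s).toNat.factorial : ℝ) * ((l - s).toNat.factorial : ℝ) := by
    positivity
  rw [alm, ← Real.sqrt_div' _ hpos.le, sub_neg_eq_add, ← sub_eq_add_neg]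
  congr 1
  field_simp

/-- The dependence of `ₛY_{lm}` on `φ` is the phase `e^{imφ}`. -/
theorem sY_eq_exp_mul (s l m : ℤ) (θ φ : ℝ) :
    sY s l m (θ, φ) = Complex.exp (Complex.I * (m : ℂ) * (φ : ℂ)) * sY s l m (θ, 0) := by
  simp only [sY, Complex.ofReal_zero, mul_zero, Complex.exp_zero, one_mul, mul_assoc]

open Filter Topology in
/-- The limit of `ₛY_{lm}` at the north pole along the meridian `φ = 0`. -/
theorem tendsto_sY_zero (s l m : ℤ) (hl : |s| ≤ l) :
    Tendsto (fun θ : ℝ => sY s l m (θ, 0)) (𝓝[>] 0)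
      (𝓝 (if m = -s then
        (-1 : ℂ) ^ (max s 0) * (Real.sqrt ((2 * (l : ℝ) + 1) / (4 * Real.pi)) : ℂ)
      else 0)) := by
  have ht := (tendsto_finsetSum (Finset.Icc (0 : ℤ) (l - s))
    fun r _ => tendsto_sY_summand s l m r).const_mul ((-1 : ℂ) ^ (max (-m) 0) *
    ((alm l m / Real.sqrt (((l + s).toNat.factorial : ℝ) *
      ((l - s).toNat.factorial : ℝ)) : ℝ) : ℂ))
  have hmem : l - s ∈ Finset.Icc (0 : ℤ) (l - s) := by
    have := abs_le.1 hl
    exact Finset.mem_Icc.2 ⟨by omega, le_rfl⟩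
  rw [Finset.sum_ite_eq', if_pos hmem] at ht
  convert ht using 2
  · simp only [sY, Complex.ofReal_zero, mul_zero, Complex.exp_zero, one_mul, ← Finset.mul_sum,
      mul_assoc]
  · by_cases hms : m = -s
    · subst hms
      rw [if_pos rfl, if_pos ⟨rfl, hl⟩, alm_neg_div_sqrt, neg_neg, mul_one]
    · rw [if_neg hms, if_neg (fun h => hms h.1), mul_zero]

/-- **Limit of `e^{isφ} ₛY_{lm}` at the north pole, uniformly in `φ`** (Statement 7). -/
theorem sY_limit_north_pole (s l m : ℤ) (hl : |s| ≤ l) (hm : -l ≤ m) (hm' : m ≤ l) :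
    ∀ ε : ℝ, 0 < ε → ∃ δ : ℝ, 0 < δ ∧ ∀ θ φ : ℝ, 0 < θ → θ < δ →
      ‖Complex.exp (Complex.I * (s : ℂ) * (φ : ℂ)) * sY s l m (θ, φ) -
          (if m = -s then
            (-1 : ℂ) ^ (max s 0) * (Real.sqrt ((2 * (l : ℝ) + 1) / (4 * Real.pi)) : ℂ)
          else 0)‖ < ε := by
  intro ε hε
  obtain ⟨δ, hδ, h⟩ := Metric.tendsto_nhdsWithin_nhds.1 (tendsto_sY_zero s l m hl) ε hε
  refine ⟨δ, hδ, fun θ φ hθ hθδ => ?_⟩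
  have hdist := h (x := θ) hθ (by rwa [Real.dist_eq, sub_zero, abs_of_pos hθ])
  rw [dist_eq_norm] at hdist
  rw [sY_eq_exp_mul, ← mul_assoc, ← Complex.exp_add]
  by_cases hms : m = -s
  · subst hms
    have hphase : Complex.I * (s : ℂ) * (φ : ℂ) + Complex.I * ((-s : ℤ) : ℂ) * (φ : ℂ) = 0 := by
      push_cast
      ring
    rwa [hphase, Complex.exp_zero, one_mul]
  · rw [if_neg hms, sub_zero] at hdist ⊢
    have hphase : Complex.I * (s : ℂ) * (φ : ℂ) + Complex.I * (m : ℂ) * (φ : ℂ) =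
        (((s + m) * φ : ℝ) : ℂ) * Complex.I := by
      push_cast
      ring
    rwa [norm_mul, hphase, Complex.norm_exp_ofReal_mul_I, one_mul]
end
end
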